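/- Assume the Riemann Hypothesis. Let k ≥ 3·10^13 be an integer and let n be an integer with 1 ≤ n ≤ log(k·log k) − 1. Then 2·π(nk + k/2) − π(nk) − π(nk + k) > 0. -/

import Mathlib

open scoped BigOperators

/-- Number of primes not exceeding the real number `x` (so `primePi x = 0` for `x ≤ 1`). -/
noncomputable def primePi (x : ℝ) : ℕ :=
  ((Finset.range (⌊x⌋₊ + 1)).filter Nat.Prime).card

/-- The `n`-th prime, with `nthPrime 1 = 2`, `nthPrime 2 = 3`, etc. -/
noncomputable def nthPrime (n : ℕ) : ℕ := Nat.nth Nat.Prime (n - 1)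

section

open Filter Topology Metric Set

theorem exists_factor_pow {F : ℂ → ℂ} (hF : Differentiable ℂ F) {w : ℂ} (hw : F w ≠ 0) (a : ℂ) :
    ∃ G : ℂ → ℂ, Differentiable ℂ G ∧ (∀ z, F z = (z - a) ^ analyticOrderNatAt F a * G z) ∧
      G a ≠ 0 := by
  have hFa : AnalyticAt ℂ F a := hF.analyticAt a
  have hne : analyticOrderAt F a ≠ ⊤ := by
    rw [Ne, analyticOrderAt_eq_top]
    intro h
    exact hw (AnalyticOnNhd.eqOn_zero_of_preconnected_of_eventuallyEq_zero
      (fun z _ => hF.analyticAt z) isPreconnected_univ (mem_univ a) h (mem_univ w))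
  obtain ⟨g, hg, hga, hFg⟩ := hFa.analyticOrderAt_ne_top.1 hne
  set m := analyticOrderNatAt F a
  have hfac : ∀ z, F z = (z - a) ^ m * (if z = a then g a else F z / (z - a) ^ m) := by
    intro z
    split_ifs with h
    · have := hFg.self_of_nhds
      simpa [h] using this
    · have : (z - a) ^ m ≠ 0 := pow_ne_zero _ (sub_ne_zero.2 h)
      field_simp
  refine ⟨fun z => if z = a then g a else F z / (z - a) ^ m, ?_, hfac, by simpa using hga⟩
  intro z
  rcases eq_or_ne z a with rfl | h
  · refine hg.differentiableAt.congr_of_eventuallyEq ?_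
    filter_upwards [hFg] with y hy
    split_ifs with h
    · rw [h]
    · have : (y - z) ^ m ≠ 0 := pow_ne_zero _ (sub_ne_zero.2 h)
      rw [hy, smul_eq_mul]; field_simp
  · have h1 : DifferentiableAt ℂ (fun y => F y / (y - a) ^ m) z :=
      (hF z).div (by fun_prop) (pow_ne_zero _ (sub_ne_zero.2 h))
    refine h1.congr_of_eventuallyEq ?_
    filter_upwards [isOpen_ne.mem_nhds h] with y hy
    simp [show y ≠ a from hy]

theorem exists_factor_prod {F : ℂ → ℂ} (hF : Differentiable ℂ F) {w : ℂ} (hw : F w ≠ 0)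
    (S : Finset ℂ) :
    ∃ G : ℂ → ℂ, Differentiable ℂ G ∧
      (∀ z, F z = (∏ a ∈ S, (z - a) ^ analyticOrderNatAt F a) * G z) ∧ ∀ a ∈ S, G a ≠ 0 := by
  induction S using Finset.induction_on with
  | empty => exact ⟨F, hF, by simp, by simp⟩
  | insert a S ha ih =>
    obtain ⟨G, hG, hfac, hGS⟩ := ih
    have hGw : G w ≠ 0 := fun h => hw (by rw [hfac w, h, mul_zero])
    obtain ⟨K, hK, hKfac, hKa⟩ := exists_factor_pow hG hGw a
    have hord : analyticOrderNatAt F a = analyticOrderNatAt G a := by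
      unfold analyticOrderNatAt
      congr 1
      have hPd : AnalyticAt ℂ (fun z => ∏ b ∈ S, (z - b) ^ analyticOrderNatAt F b) a :=
        (Differentiable.analyticAt (by fun_prop) a)
      have hP0 : (∏ b ∈ S, (a - b) ^ analyticOrderNatAt F b) ≠ 0 :=
        Finset.prod_ne_zero_iff.2 fun b hb =>
          pow_ne_zero _ (sub_ne_zero.2 fun h => ha (h ▸ hb))
      have : F = (fun z => ∏ b ∈ S, (z - b) ^ analyticOrderNatAt F b) * G := by
        ext z; exact hfac z
      conv_lhs => rw [this]
      rw [analyticOrderAt_mul hPd (hG.analyticAt a),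
        hPd.analyticOrderAt_eq_zero.2 hP0, zero_add]
    refine ⟨K, hK, fun z => ?_, ?_⟩
    · rw [Finset.prod_insert ha, hfac z, hKfac z, hord]; ring
    · intro b hb
      rcases Finset.mem_insert.1 hb with rfl | hb
      · exact hKa
      · intro h
        exact hGS b hb (by rw [hKfac b, h, mul_zero])

theorem logDeriv_factor {F G : ℂ → ℂ} (hG : Differentiable ℂ G) (S : Finset ℂ) (m : ℂ → ℕ)
    (hfac : ∀ z, F z = (∏ a ∈ S, (z - a) ^ m a) * G z) {z : ℂ} (hz : ∀ a ∈ S, z ≠ a)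
    (hGz : G z ≠ 0) :
    logDeriv F z = ∑ a ∈ S, (m a : ℂ) / (z - a) + logDeriv G z := by
  have hFe : F = fun z => (∏ a ∈ S, (z - a) ^ m a) * G z := funext hfac
  have hne : ∀ a ∈ S, (z - a) ^ m a ≠ 0 := fun a ha => pow_ne_zero _ (sub_ne_zero.2 (hz a ha))
  rw [hFe, logDeriv_mul (f := fun z => ∏ a ∈ S, (z - a) ^ m a) (g := G) z
    (Finset.prod_ne_zero_iff.2 hne) hGz (by fun_prop) (hG z)]
  congr 1
  rw [logDeriv_prod (f := fun a z => (z - a) ^ m a) hne (fun a _ => by fun_prop)]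
  refine Finset.sum_congr rfl fun a _ => ?_
  rw [logDeriv_fun_pow (by fun_prop)]
  simp [logDeriv_apply, div_eq_mul_inv]

/-- Borel–Carathéodory for the logarithm of a zero-free function, differentiated twice. -/
theorem norm_deriv_logDeriv_le {G : ℂ → ℂ} (hG : Differentiable ℂ G) {c : ℂ} {r M : ℝ}
    (hr : 0 < r) (hM : 0 < M) (hne : ∀ z ∈ ball c r, G z ≠ 0)
    (hle : ∀ z ∈ ball c r, ‖G z‖ ≤ Real.exp M * ‖G c‖) {z : ℂ} (hz : z ∈ closedBall c (r / 4)) :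
    ‖deriv (logDeriv G) z‖ ≤ 96 * M / r ^ 2 := by
  have hGd : Differentiable ℂ (deriv G) := hG.deriv
  have hdl : DifferentiableOn ℂ (logDeriv G) (ball c r) := fun w hw =>
    ((hGd w).div (hG w) (hne w hw)).differentiableWithinAt
  obtain ⟨l, hlc, hl⟩ := hdl.isExactOn_ball.with_val_at c 0
  have hcm : c ∈ ball c r := mem_ball_self hr
  have hexp : ∀ w ∈ ball c r, G w * Complex.exp (-l w) = G c := by
    intro w hw
    have := (convex_ball c r).is_const_of_fderivWithin_eq_zero (𝕜 := ℂ)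
      (f := fun w => G w * Complex.exp (-l w)) (s := ball c r)
      (fun w hw => ((hG w).mul ((hl w hw).differentiableAt.neg.cexp)).differentiableWithinAt)
      (fun w hw => ?_) hw hcm
    · simpa [hlc] using this
    · have h1 : HasDerivAt (fun w => G w * Complex.exp (-l w)) 0 w := by
        have := (hG w).hasDerivAt.mul ((hl w hw).neg.cexp)
        refine this.congr_deriv ?_
        have h0 := hne w hw
        rw [logDeriv_apply]; field_simp; simp
      have h2 := h1.hasFDerivAt.hasFDerivWithinAt (s := ball c r)
      rw [h2.fderivWithin (isOpen_ball.uniqueDiffWithinAt hw)]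
      ext; simp
  have hre : ∀ w ∈ ball c r, (l w).re ≤ M := by
    intro w hw
    have h1 := hexp w hw
    have h2 : G w = G c * Complex.exp (l w) := by
      rw [← h1, mul_assoc, ← Complex.exp_add]; simp
    have h3 := hle w hw
    rw [h2, norm_mul, Complex.norm_exp] at h3
    have h4 : 0 < ‖G c‖ := norm_pos_iff.2 (hne c hcm)
    rw [mul_comm] at h3
    exact Real.exp_le_exp.1 (le_of_mul_le_mul_right h3 h4)
  have hlbd : ∀ w ∈ closedBall c (3 * r / 4), ‖l w‖ ≤ 6 * M := by
    intro w hw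
    rw [mem_closedBall, dist_eq_norm] at hw
    have hmaps : ∀ x ∈ ball (0:ℂ) r, x + c ∈ ball c r := by
      intro x hx; simpa using hx
    have := Complex.borelCaratheodory_zero (f := fun x => l (x + c)) (M := M) (R := r)
      (z := w - c) hM (fun x hx => ?_) (fun x hx => hre _ (hmaps x hx)) hr
      (by rw [mem_ball_zero_iff]; linarith) (by simpa using hlc)
    · simp only [sub_add_cancel] at this
      refine this.trans ?_
      rw [div_le_iff₀ (by linarith)]
      nlinarith [norm_nonneg (w - c)]
    · have h1 := (hl (x + c) (hmaps x hx)).differentiableAt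
      exact (h1.comp x (by fun_prop)).differentiableWithinAt
  have hld : ∀ w ∈ closedBall c (r / 2), ‖logDeriv G w‖ ≤ 24 * M / r := by
    intro w hw
    rw [mem_closedBall] at hw
    have hsub : closedBall w (r / 4) ⊆ closedBall c (3 * r / 4) := by
      intro x hx
      rw [mem_closedBall] at *
      linarith [dist_triangle x w c]
    have hsub2 : closedBall c (3 * r / 4) ⊆ ball c r := closedBall_subset_ball (by linarith)
    have := Complex.norm_deriv_le_of_forall_mem_sphere_norm_le (f := l) (c := w) (R := r / 4)
      (C := 6 * M) (by positivity)
      (DifferentiableOn.diffContOnCl_ball (fun x hx => (hl x (hsub2 (hsub hx))).differentiableAt.differentiableWithinAt) subset_rfl)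
      (fun x hx => hlbd x (hsub (sphere_subset_closedBall hx)))
    rw [(hl w (hsub2 (hsub (mem_closedBall_self (by positivity))))).deriv] at this
    refine this.trans (le_of_eq ?_)
    field_simp; norm_num
  rw [mem_closedBall] at hz
  have hsub : closedBall z (r / 4) ⊆ closedBall c (r / 2) := by
    intro x hx
    rw [mem_closedBall] at *
    linarith [dist_triangle x z c]
  have hsub2 : closedBall c (r / 2) ⊆ ball c r := closedBall_subset_ball (by linarith)
  have := Complex.norm_deriv_le_of_forall_mem_sphere_norm_le (f := logDeriv G) (c := z)
      (R := r / 4) (C := 24 * M / r) (by positivity)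
      ((hdl.mono (hsub2)).mono hsub |>.diffContOnCl_ball subset_rfl)
      (fun x hx => hld x (hsub (sphere_subset_closedBall hx)))
  refine this.trans (le_of_eq ?_)
  field_simp; norm_num

end

section

open Filter Topology Metric Set

theorem finite_zeros_closedBall {F : ℂ → ℂ} (hF : Differentiable ℂ F) {w : ℂ} (hw : F w ≠ 0)
    (R : ℝ) : {a : ℂ | ‖a‖ ≤ R ∧ F a = 0}.Finite := by
  have h : F ⁻¹' {0}ᶜ ∈ codiscrete ℂ :=
    AnalyticOnNhd.preimage_zero_mem_codiscrete (fun z _ => hF.analyticAt z) hw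
  have h2 := mem_codiscrete'.mp h
  have h3 : (F ⁻¹' {0}ᶜ)ᶜ = F ⁻¹' {0} := by ext; simp
  have hcl : IsClosed (F ⁻¹' {0}) := isClosed_singleton.preimage hF.continuous
  have hd : IsDiscrete (F ⁻¹' {0}) := by simpa [h3] using h2.2
  have h4 : (closedBall (0:ℂ) R ∩ F ⁻¹' {0}).Finite :=
    ((isCompact_closedBall 0 R).inter_right hcl).finite (hd.mono inter_subset_right)
  refine h4.subset fun a ha => ⟨by simpa using ha.1, ha.2⟩

theorem norm_logDeriv_sub_sum_le {F : ℂ → ℂ} (hF : Differentiable ℂ F) (heven : ∀ z, F (-z) = F z)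
    (h1 : F 1 ≠ 0) {R N : ℝ} (hR : 2 ≤ R) (hN : 0 < N)
    (hgrow : ∀ z, ‖z‖ ≤ 3 * R → ‖F z‖ ≤ Real.exp N * ‖F 1‖) (S : Finset ℂ)
    (hS : ∀ a, a ∈ S ↔ ‖a‖ ≤ R ∧ F a = 0) {z : ℂ} (hz : F z ≠ 0) (hzR : 8 * (1 + ‖z‖) ≤ R) :
    ‖logDeriv F z - ∑ a ∈ S, (analyticOrderNatAt F a : ℂ) * (z / (z ^ 2 - a ^ 2))‖ ≤
      384 * N / R ^ 2 * ‖z‖ := by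
  obtain ⟨G, hG, hfac, hGS⟩ := exists_factor_prod hF h1 S
  set m := analyticOrderNatAt F
  have hG0 : ∀ w, ‖w‖ ≤ R → G w ≠ 0 := by
    intro w hw hGw
    by_cases hwS : w ∈ S
    · exact hGS w hwS hGw
    · exact hwS ((hS w).2 ⟨hw, by rw [hfac, hGw, mul_zero]⟩)
  have hG1 : G 1 ≠ 0 := fun h => h1 (by rw [hfac, h, mul_zero])
  have hP : ∀ w, ‖w‖ = 3 * R → ‖∏ a ∈ S, (1 - a) ^ m a‖ ≤ ‖∏ a ∈ S, (w - a) ^ m a‖ := by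
    intro w hw
    rw [norm_prod, norm_prod]
    refine Finset.prod_le_prod (fun _ _ => norm_nonneg _) fun a ha => ?_
    rw [norm_pow, norm_pow]
    refine pow_le_pow_left₀ (norm_nonneg _) ?_ _
    have h2 := ((hS a).1 ha).1
    have h3 := norm_sub_norm_le w a
    have h4 := norm_sub_le (1:ℂ) a
    rw [norm_one] at h4
    linarith
  have hGle : ∀ w, ‖w‖ ≤ 3 * R → ‖G w‖ ≤ Real.exp N * ‖G 1‖ := by
    intro w hw
    have hmem : w ∈ closure (ball (0:ℂ) (3 * R)) := by
      rw [closure_ball _ (by positivity)]; simpa using hw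
    refine Complex.norm_le_of_forall_mem_frontier_norm_le isBounded_ball hG.diffContOnCl
      (fun x hx => ?_) hmem
    rw [frontier_ball _ (by positivity), mem_sphere_zero_iff_norm] at hx
    have h2 := hgrow x hx.le
    rw [hfac x, hfac 1, norm_mul, norm_mul] at h2
    have h3 := hP x hx
    have h4 : 0 < ‖∏ a ∈ S, (1 - a) ^ m a‖ := by
      rw [norm_pos_iff]; intro h; exact h1 (by rw [hfac, h, zero_mul])
    have h5 : ‖∏ a ∈ S, (1 - a) ^ m a‖ * ‖G x‖ ≤
        ‖∏ a ∈ S, (1 - a) ^ m a‖ * (Real.exp N * ‖G 1‖) :=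
      (mul_le_mul_of_nonneg_right h3 (norm_nonneg _)).trans (by linarith)
    exact le_of_mul_le_mul_left h5 h4
  have hsub : ∀ w ∈ ball (1:ℂ) (R - 1), ‖w‖ ≤ R := by
    intro w hw
    rw [mem_ball, dist_eq_norm] at hw
    have := norm_add_le (w - 1) 1
    rw [sub_add_cancel, norm_one] at this
    linarith
  have hbd : ∀ w ∈ closedBall (1:ℂ) ((R - 1) / 4), ‖deriv (logDeriv G) w‖ ≤ 384 * N / R ^ 2 := by
    intro w hw
    have h2 := norm_deriv_logDeriv_le hG (c := 1) (r := R - 1) (by linarith) hN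
      (fun w hw => hG0 w (hsub w hw))
      (fun w hw => hGle w ((hsub w hw).trans (by linarith))) hw
    refine h2.trans ?_
    rw [div_le_div_iff₀ (by nlinarith) (by positivity)]
    have : R ^ 2 ≤ 4 * (R - 1) ^ 2 := by nlinarith
    nlinarith
  have hGd : Differentiable ℂ (deriv G) := hG.deriv
  have hdiff : ∀ w ∈ closedBall (1:ℂ) ((R - 1) / 4), DifferentiableAt ℂ (logDeriv G) w := by
    intro w hw
    exact (hGd w).div (hG w) (hG0 w (hsub w (closedBall_subset_ball (by linarith) hw)))
  have hzm : ∀ w : ℂ, ‖w‖ = ‖z‖ → w ∈ closedBall (1:ℂ) ((R - 1) / 4) := by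
    intro w hw
    rw [mem_closedBall, dist_eq_norm]
    have := norm_sub_le w 1
    rw [norm_one] at this
    linarith [norm_nonneg z]
  have hmv := (convex_closedBall (1:ℂ) ((R - 1) / 4)).norm_image_sub_le_of_norm_deriv_le
    hdiff hbd (hzm (-z) (norm_neg z)) (hzm z rfl)
  have hzn : F (-z) ≠ 0 := by rwa [heven]
  have hne : ∀ w, F w ≠ 0 → ∀ a ∈ S, w ≠ a := by
    rintro w hw a ha rfl
    exact hw ((hS w).1 ha).2
  have hGne : ∀ w, F w ≠ 0 → G w ≠ 0 := by
    intro w hw h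
    exact hw (by rw [hfac, h, mul_zero])
  have hl1 := logDeriv_factor hG S m hfac (hne z hz) (hGne z hz)
  have hl2 := logDeriv_factor hG S m hfac (hne _ hzn) (hGne _ hzn)
  have hodd : logDeriv F (-z) = - logDeriv F z := by
    have h2 : deriv F (-z) = - deriv F z := by
      have h3 : F = fun z => F (-z) := funext fun z => (heven z).symm
      have h4 := deriv_comp_neg F z
      rw [← h3] at h4
      rw [h4, neg_neg]
    rw [logDeriv_apply, logDeriv_apply, heven, h2, neg_div]
  have hkey : 2 * (logDeriv F z - ∑ a ∈ S, (m a : ℂ) * (z / (z ^ 2 - a ^ 2))) =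
      logDeriv G z - logDeriv G (-z) := by
    have h2 : 2 * logDeriv F z = logDeriv F z - logDeriv F (-z) := by rw [hodd]; ring
    have h3 : 2 * ∑ a ∈ S, (m a : ℂ) * (z / (z ^ 2 - a ^ 2)) =
        ∑ a ∈ S, (m a : ℂ) / (z - a) - ∑ a ∈ S, (m a : ℂ) / (-z - a) := by
      rw [Finset.mul_sum, ← Finset.sum_sub_distrib]
      refine Finset.sum_congr rfl fun a ha => ?_
      have h4 : z - a ≠ 0 := sub_ne_zero.2 (hne z hz a ha)
      have h5 : z + a ≠ 0 := by
        intro h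
        have : -z - a ≠ 0 := sub_ne_zero.2 (hne _ hzn a ha)
        exact this (by linear_combination -h)
      have h6 : z ^ 2 - a ^ 2 ≠ 0 := by
        rw [show z ^ 2 - a ^ 2 = (z - a) * (z + a) by ring]; exact mul_ne_zero h4 h5
      have h7 : -z - a ≠ 0 := sub_ne_zero.2 (hne _ hzn a ha)
      rw [show -z - a = -(z + a) by ring, show z ^ 2 - a ^ 2 = (z - a) * (z + a) by ring]
      field_simp
      ring
    rw [mul_sub, h2, h3, hl1, hl2]; ring
  have hfin : 2 * ‖logDeriv F z - ∑ a ∈ S, (m a : ℂ) * (z / (z ^ 2 - a ^ 2))‖ ≤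
      384 * N / R ^ 2 * (2 * ‖z‖) := by
    have h2 := congrArg norm hkey
    rw [norm_mul, Complex.norm_ofNat] at h2
    rw [h2]
    refine hmv.trans (le_of_eq ?_)
    rw [show z - -z = 2 * z by ring, norm_mul, Complex.norm_ofNat]
  linarith

/-- The Hadamard partial fraction expansion for an even entire function with purely imaginary
zeros and of growth order below two. -/
theorem hasSum_logDeriv_of_even {F : ℂ → ℂ} (hF : Differentiable ℂ F)
    (heven : ∀ z, F (-z) = F z) (hzero : ∀ z, F z = 0 → z.re = 0)
    (hgrow : ∀ ε > 0, ∃ C : ℝ, ∀ z, ‖F z‖ ≤ Real.exp (ε * ‖z‖ ^ 2 + C)) {z : ℂ} (hz : 0 < z.re) :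
    HasSum (fun γ : {γ : ℝ // F (Complex.I * γ) = 0} =>
      (analyticOrderNatAt F (Complex.I * γ) : ℂ) * (z / (z ^ 2 + (γ : ℂ) ^ 2))) (logDeriv F z) := by
  have hF0 : ∀ z : ℂ, 0 < z.re → F z ≠ 0 := fun z hz h => hz.ne' (hzero z h)
  have h1 : F 1 ≠ 0 := hF0 1 (by simp)
  let Z := {γ : ℝ // F (Complex.I * γ) = 0}
  have hfin : ∀ R : ℝ, {γ : Z | |(γ : ℝ)| ≤ R}.Finite := by
    intro R
    refine ((finite_zeros_closedBall hF h1 R).preimage (f := fun γ : Z => Complex.I * (γ : ℝ))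
      ?_).subset ?_
    · intro a _ b _ hab
      have := mul_left_cancel₀ Complex.I_ne_zero hab
      exact Subtype.ext (Complex.ofReal_injective this)
    · intro γ hγ
      refine ⟨?_, γ.2⟩
      simpa using hγ
  let T : ℝ → Finset Z := fun R => (hfin R).toFinset
  have hT : ∀ R γ, γ ∈ T R ↔ |(γ : ℝ)| ≤ R := fun R γ => by simp [T]
  have hTtop : Tendsto T atTop atTop := by
    refine tendsto_atTop_finset_of_monotone (fun R R' h γ hγ => ?_) fun γ => ⟨|(γ : ℝ)|, ?_⟩
    · rw [hT] at *; exact hγ.trans h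
    · rw [hT]
  set m : Z → ℕ := fun γ => analyticOrderNatAt F (Complex.I * (γ : ℝ))
  have hlim : ∀ w : ℂ, 0 < w.re → Tendsto (fun R => ∑ γ ∈ T R, (m γ : ℂ) *
      (w / (w ^ 2 + ((γ : ℝ) : ℂ) ^ 2))) atTop (𝓝 (logDeriv F w)) := by
    intro w hw
    rw [Metric.tendsto_atTop]
    intro δ hδ
    set ε : ℝ := δ / (2 * (384 * 9) * (‖w‖ + 1)) with hε
    have hε0 : 0 < ε := by positivity
    obtain ⟨C, hC⟩ := hgrow ε hε0
    set C' : ℝ := |C - Real.log ‖F 1‖| + 1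
    have hC' : 0 < C' := by positivity
    obtain ⟨R₀, hR₀⟩ : ∃ R₀ : ℝ, ∀ R ≥ R₀, 384 * C' * ‖w‖ * 2 < δ * R ^ 2 ∧ 8 * (1 + ‖w‖) ≤ R := by
      have h2 : Tendsto (fun R : ℝ => δ * R ^ 2) atTop atTop :=
        (tendsto_pow_atTop two_ne_zero).const_mul_atTop hδ
      have := (h2.eventually_gt_atTop (384 * C' * ‖w‖ * 2)).and
        (eventually_ge_atTop (8 * (1 + ‖w‖)))
      exact eventually_atTop.1 this
    refine ⟨R₀, fun R hR => ?_⟩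
    obtain ⟨hRa, hRb⟩ := hR₀ R hR
    have hR2 : 2 ≤ R := by linarith [norm_nonneg w]
    have hinj : Set.InjOn (fun γ : Z => Complex.I * ((γ : ℝ) : ℂ)) (T R) := by
      intro a _ b _ hab
      have := mul_left_cancel₀ Complex.I_ne_zero hab
      exact Subtype.ext (Complex.ofReal_injective this)
    have hSmem : ∀ a, a ∈ (T R).image (fun γ : Z => Complex.I * ((γ : ℝ) : ℂ)) ↔
        ‖a‖ ≤ R ∧ F a = 0 := by
      intro a
      rw [Finset.mem_image]
      constructor
      · rintro ⟨γ, hγ, rfl⟩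
        refine ⟨?_, γ.2⟩
        rw [hT] at hγ; simpa using hγ
      · rintro ⟨ha, ha0⟩
        have hae : Complex.I * ((a.im : ℝ) : ℂ) = a := by
          have := hzero a ha0
          apply Complex.ext <;> simp [this]
        refine ⟨⟨a.im, by rwa [hae]⟩, ?_, hae⟩
        rw [hT]; exact (Complex.abs_im_le_norm a).trans ha
    have hN : 0 < ε * 9 * R ^ 2 + C' := by positivity
    have hkey := norm_logDeriv_sub_sum_le hF heven h1 hR2 hN (fun x hx => ?_) _ hSmem
      (hF0 w hw) hRb
    · rw [Finset.sum_image hinj] at hkey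
      rw [dist_comm, dist_eq_norm]
      have hcongr : ∑ γ ∈ T R, (m γ : ℂ) * (w / (w ^ 2 + ((γ : ℝ) : ℂ) ^ 2)) =
          ∑ γ ∈ T R, (analyticOrderNatAt F (Complex.I * ((γ : ℝ) : ℂ)) : ℂ) *
            (w / (w ^ 2 - (Complex.I * ((γ : ℝ) : ℂ)) ^ 2)) := by
        refine Finset.sum_congr rfl fun γ _ => ?_
        rw [mul_pow, Complex.I_sq]; congr 2; ring
      rw [hcongr]
      refine hkey.trans_lt ?_
      have e1 : 384 * (ε * 9 * R ^ 2 + C') / R ^ 2 * ‖w‖ =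
          ε * (384 * 9) * ‖w‖ + 384 * C' * ‖w‖ / R ^ 2 := by
        field_simp
      have e2 : ε * (384 * 9) * ‖w‖ ≤ δ / 2 := by
        have : ε * (2 * (384 * 9) * (‖w‖ + 1)) = δ := by rw [hε]; field_simp
        nlinarith
      have e3 : 384 * C' * ‖w‖ / R ^ 2 < δ / 2 := by
        rw [div_lt_iff₀ (by positivity)]; linarith
      rw [e1]; linarith
    · refine (hC x).trans ?_
      have h3 : 0 < ‖F 1‖ := norm_pos_iff.2 h1
      conv_rhs => rw [← Real.exp_log h3, ← Real.exp_add]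
      rw [Real.exp_le_exp]
      have h4 : ‖x‖ ^ 2 ≤ 9 * R ^ 2 := by nlinarith [norm_nonneg x]
      have h5 := le_abs_self (C - Real.log ‖F 1‖)
      have h6 : ε * ‖x‖ ^ 2 ≤ ε * (9 * R ^ 2) := by gcongr
      simp only [C']; linarith
  have hsum1 : Summable (fun γ : Z => (m γ : ℝ) * (1 / (1 + (γ : ℝ) ^ 2))) := by
    have h2 := hlim 1 (by simp)
    have h3 := (Complex.continuous_re.tendsto _).comp h2
    refine summable_of_sum_le (c := (logDeriv F 1).re) (fun γ => by positivity) fun u => ?_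
    refine ge_of_tendsto h3 ?_
    filter_upwards [hTtop.eventually_ge_atTop u] with R hR
    simp only [Function.comp_apply, one_pow]
    have : (∑ γ ∈ T R, (m γ : ℂ) * (1 / (1 + ((γ : ℝ) : ℂ) ^ 2))) =
        ((∑ γ ∈ T R, (m γ : ℝ) * (1 / (1 + (γ : ℝ) ^ 2)) : ℝ) : ℂ) := by push_cast; rfl
    rw [this, Complex.ofReal_re]
    exact Finset.sum_le_sum_of_subset_of_nonneg hR fun γ _ _ => by positivity
  have hsum : Summable (fun γ : Z => (m γ : ℂ) * (z / (z ^ 2 + ((γ : ℝ) : ℂ) ^ 2))) := by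
    set K : ℝ := 1 + 4 * ‖z‖ ^ 2 with hK
    refine Summable.of_norm_bounded (g := fun γ : Z => (‖z‖ * (K / z.re ^ 2)) *
      ((m γ : ℝ) * (1 / (1 + (γ : ℝ) ^ 2)))) (hsum1.mul_left _) fun γ => ?_
    have e0 : z ^ 2 + ((γ : ℝ) : ℂ) ^ 2 = (z + Complex.I * (γ : ℝ)) *
        (z + Complex.I * (-(γ : ℝ) : ℝ)) := by
      push_cast
      linear_combination (((γ : ℝ) : ℂ) ^ 2) * Complex.I_sq
    have key : ∀ t : ℝ, z.re ^ 2 * (1 + t ^ 2) ≤ K * ‖z + Complex.I * t‖ ^ 2 := by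
      intro t
      have f1 : z.re ≤ ‖z + Complex.I * t‖ := by
        simpa using Complex.re_le_norm (z + Complex.I * t)
      have f2 : |t| ≤ ‖z + Complex.I * t‖ + ‖z‖ := by
        have := norm_sub_le (z + Complex.I * t) z
        rwa [add_sub_cancel_left, norm_mul, Complex.norm_I, one_mul, Complex.norm_real,
          Real.norm_eq_abs] at this
      have f3 : z.re ≤ ‖z‖ := Complex.re_le_norm z
      have f4 : z.re * |t| ≤ (‖z‖ + ‖z‖) * ‖z + Complex.I * t‖ := by
        nlinarith [norm_nonneg z, abs_nonneg t]
      have f5 : z.re ^ 2 * t ^ 2 ≤ ((‖z‖ + ‖z‖) * ‖z + Complex.I * t‖) ^ 2 := by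
        rw [← sq_abs t, ← mul_pow]
        exact pow_le_pow_left₀ (by positivity) f4 2
      have f6 := pow_le_pow_left₀ hz.le f1 2
      rw [hK]; linarith
    have hprod : z.re ^ 2 * (1 + (γ : ℝ) ^ 2) ≤ K * ‖z ^ 2 + ((γ : ℝ) : ℂ) ^ 2‖ := by
      refine abs_le_of_sq_le_sq' ?_ (by positivity) |>.2
      rw [e0, norm_mul]
      have g1 := key γ
      have g2 := key (-γ)
      rw [neg_sq] at g2
      have := mul_le_mul g1 g2 (by positivity) (by positivity)
      nlinarith
    have hpos : 0 < ‖z ^ 2 + ((γ : ℝ) : ℂ) ^ 2‖ := by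
      by_contra h
      have h0 : ‖z ^ 2 + ((γ : ℝ) : ℂ) ^ 2‖ = 0 := le_antisymm (not_lt.1 h) (norm_nonneg _)
      rw [h0, mul_zero] at hprod
      have : 0 < z.re ^ 2 * (1 + (γ : ℝ) ^ 2) := by positivity
      linarith
    rw [norm_mul, norm_div, Complex.norm_natCast]
    have : ‖z‖ / ‖z ^ 2 + ((γ : ℝ) : ℂ) ^ 2‖ ≤ ‖z‖ * (K / z.re ^ 2) * (1 / (1 + (γ : ℝ) ^ 2)) := by
      rw [div_eq_mul_inv, mul_assoc]
      refine mul_le_mul_of_nonneg_left ?_ (norm_nonneg _)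
      rw [div_mul_div_comm, mul_one, inv_eq_one_div, div_le_div_iff₀ hpos (by positivity)]
      linarith
    calc (m γ : ℝ) * (‖z‖ / ‖z ^ 2 + ((γ : ℝ) : ℂ) ^ 2‖)
        ≤ (m γ : ℝ) * (‖z‖ * (K / z.re ^ 2) * (1 / (1 + (γ : ℝ) ^ 2))) := by gcongr
      _ = _ := by ring
  have h2 := hsum.hasSum
  rwa [tendsto_nhds_unique (h2.comp hTtop) (hlim z hz)] at h2

end

section

open Filter Topology Metric Set MeasureTheory HurwitzZeta

theorem integrable_exp_log_sq_mul_evenKernel {c : ℝ} (hc : 0 < c) :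
    IntegrableOn (fun t : ℝ => Real.exp (c * (Real.log t) ^ 2) * |evenKernel 0 t - 1|) (Ioi 1) := by
  obtain ⟨p, hp, hO⟩ := isBigO_atTop_evenKernel_sub 0
  simp only [if_true] at hO
  refine integrable_of_isBigO_exp_neg (b := p / 2) (half_pos hp) ?_ ?_
  · have h1 : ContinuousOn (fun t => evenKernel 0 t) (Ici 1) :=
      (continuousOn_evenKernel 0).mono fun t ht => lt_of_lt_of_le one_pos (mem_Ici.1 ht)
    have h2 : ContinuousOn Real.log (Ici (1:ℝ)) :=
      Real.continuousOn_log.mono fun t ht => (lt_of_lt_of_le one_pos (mem_Ici.1 ht)).ne'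
    fun_prop
  · have h1 : (fun t : ℝ => Real.exp (c * (Real.log t) ^ 2)) =O[atTop]
        fun t => Real.exp (p / 2 * t) := by
      refine Asymptotics.IsBigO.of_bound 1 ?_
      have h2 := (Real.isLittleO_pow_log_id_atTop (n := 2)).bound (c := p / (2 * c)) (by positivity)
      filter_upwards [h2, eventually_gt_atTop 0] with t ht ht0
      rw [Real.norm_of_nonneg (by positivity), id, Real.norm_of_nonneg ht0.le] at ht
      rw [Real.norm_of_nonneg (by positivity), Real.norm_of_nonneg (by positivity), one_mul,
        Real.exp_le_exp]
      calc c * Real.log t ^ 2 ≤ c * (p / (2 * c) * t) := by gcongr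
        _ = p / 2 * t := by field_simp
    refine (h1.mul hO.abs_left).congr_right fun t => ?_
    rw [← Real.exp_add]; ring_nf

theorem exists_bound_completedRiemannZeta₀ {ε : ℝ} (hε : 0 < ε) :
    ∃ C : ℝ, 0 ≤ C ∧ ∀ s : ℂ, 1 / 2 ≤ s.re →
      ‖completedRiemannZeta₀ s‖ ≤ C * Real.exp (ε * ‖s‖ ^ 2) := by
  set P := hurwitzEvenFEPair 0
  set f := P.f_modif
  have hconv : ∀ s : ℂ, MellinConvergent f s := fun s =>
    (P.isStrongFEPair_toStrongFEPair.hasMellin s).1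
  set A := ∫ t in Ioi (0:ℝ), t ^ ((1:ℝ) / 4 - 1) * ‖f t‖
  set B := ∫ t in Ioi (1:ℝ), Real.exp (1 / (4 * ε) * (Real.log t) ^ 2) * |evenKernel 0 t - 1|
  have hA : 0 ≤ A := setIntegral_nonneg measurableSet_Ioi fun t ht =>
    mul_nonneg (Real.rpow_nonneg (le_of_lt ht) _) (norm_nonneg _)
  have hB : 0 ≤ B := setIntegral_nonneg measurableSet_Ioi fun t ht => by positivity
  have hAi : IntegrableOn (fun t => t ^ ((1:ℝ) / 4 - 1) * ‖f t‖) (Ioi 0) := by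
    have := (hconv (1 / 4 : ℂ)).norm
    refine (integrableOn_congr_fun (fun t ht => ?_) measurableSet_Ioi).1 this
    rw [norm_smul, Complex.norm_cpow_eq_rpow_re_of_pos ht]
    norm_num
  have hBi := integrable_exp_log_sq_mul_evenKernel (c := 1 / (4 * ε)) (by positivity)
  refine ⟨A + B, by positivity, fun s hs => ?_⟩
  have h1 : completedRiemannZeta₀ s = mellin f (s / 2) / 2 := rfl
  set w := s / 2
  have hw : w.re = s.re / 2 := by simp [w]
  have hb : ‖mellin f w‖ ≤ A + Real.exp (ε * w.re ^ 2) * B := by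
    have hind : ∫ t in Ioi (0:ℝ), (Ioi (1:ℝ)).indicator (fun t => Real.exp (ε * w.re ^ 2) *
        (Real.exp (1 / (4 * ε) * (Real.log t) ^ 2) * |evenKernel 0 t - 1|)) t =
        Real.exp (ε * w.re ^ 2) * B := by
      rw [setIntegral_indicator measurableSet_Ioi, integral_const_mul]
      congr 3
      rw [inter_eq_right.2 (Ioi_subset_Ioi zero_le_one)]
    have hint2 : IntegrableOn ((Ioi (1:ℝ)).indicator (fun t => Real.exp (ε * w.re ^ 2) *
        (Real.exp (1 / (4 * ε) * (Real.log t) ^ 2) * |evenKernel 0 t - 1|))) (Ioi 0) := by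
      refine Integrable.integrableOn ?_
      rw [integrable_indicator_iff measurableSet_Ioi]
      exact hBi.const_mul _
    rw [← hind, ← integral_add hAi hint2]
    refine norm_integral_le_of_norm_le (hAi.add hint2) ?_
    refine (ae_restrict_iff' measurableSet_Ioi).2 (ae_of_all _ fun t ht => ?_)
    have ht : 0 < t := ht
    rw [norm_smul, Complex.norm_cpow_eq_rpow_re_of_pos ht, Complex.sub_re, Complex.one_re]
    rcases le_or_gt t 1 with h | h
    · rw [indicator_of_notMem (by simpa using h), add_zero]
      refine mul_le_mul_of_nonneg_right ?_ (norm_nonneg _)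
      exact Real.rpow_le_rpow_of_exponent_ge ht h (by linarith)
    · rw [indicator_of_mem (mem_Ioi.2 h)]
      have hf : f t = ((evenKernel 0 t - 1 : ℝ) : ℂ) := by
        have h' : ¬ t < 1 := not_lt.2 h.le
        simp [f, WeakFEPair.f_modif, P, hurwitzEvenFEPair, h, h']
      rw [hf, Complex.norm_real, Real.norm_eq_abs, ← mul_assoc, ← Real.exp_add]
      have : t ^ (w.re - 1) ≤ Real.exp (ε * w.re ^ 2 + 1 / (4 * ε) * Real.log t ^ 2) := by
        refine (Real.rpow_le_rpow_of_exponent_le h.le (sub_le_self _ zero_le_one)).trans ?_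
        rw [Real.rpow_def_of_pos ht, Real.exp_le_exp]
        have h3 : 0 ≤ (2 * ε * w.re - Real.log t) ^ 2 / (4 * ε) := by positivity
        have h4 : (2 * ε * w.re - Real.log t) ^ 2 / (4 * ε) =
          ε * w.re ^ 2 + 1 / (4 * ε) * Real.log t ^ 2 - Real.log t * w.re := by
          field_simp; ring
        linarith
      have h5 : 0 ≤ t ^ ((1:ℝ) / 4 - 1) * |evenKernel 0 t - 1| := by positivity
      have h6 := mul_le_mul_of_nonneg_right this (abs_nonneg (evenKernel 0 t - 1))
      linarith
  rw [h1, norm_div, Complex.norm_ofNat]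
  have hwn : w.re ^ 2 ≤ ‖s‖ ^ 2 := by
    rw [hw]
    have := Complex.re_le_norm s
    nlinarith [norm_nonneg s]
  have hE : Real.exp (ε * w.re ^ 2) ≤ Real.exp (ε * ‖s‖ ^ 2) := by
    rw [Real.exp_le_exp]; gcongr
  have hE1 : 1 ≤ Real.exp (ε * ‖s‖ ^ 2) := Real.one_le_exp (by positivity)
  have : A + Real.exp (ε * w.re ^ 2) * B ≤ (A + B) * Real.exp (ε * ‖s‖ ^ 2) := by nlinarith
  linarith [norm_nonneg (mellin f w)]

/-- The Riemann xi function (normalised by `xi 0 = 1`), centred at the point `1 / 2`. -/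
noncomputable def centredXi (z : ℂ) : ℂ := (z ^ 2 - 1 / 4) * completedRiemannZeta₀ (1 / 2 + z) + 1

theorem differentiable_centredXi : Differentiable ℂ centredXi := by
  have h : Differentiable ℂ fun z : ℂ => completedRiemannZeta₀ (1 / 2 + z) :=
    differentiable_completedZeta₀.comp (by fun_prop)
  unfold centredXi
  fun_prop

theorem centredXi_neg (z : ℂ) : centredXi (-z) = centredXi z := by
  unfold centredXi
  rw [← completedRiemannZeta₀_one_sub]
  ring_nf

theorem centredXi_eq {s : ℂ} (h0 : s ≠ 0) (h1 : s ≠ 1) :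
    centredXi (s - 1 / 2) = s * (s - 1) * completedRiemannZeta s := by
  have h2 : 1 - s ≠ 0 := sub_ne_zero.2 h1.symm
  unfold centredXi
  rw [completedRiemannZeta_eq, add_sub_cancel]
  field_simp
  ring

theorem centredXi_growth {ε : ℝ} (hε : 0 < ε) :
    ∃ C : ℝ, ∀ z, ‖centredXi z‖ ≤ Real.exp (ε * ‖z‖ ^ 2 + C) := by
  obtain ⟨C, hC, hb⟩ := exists_bound_completedRiemannZeta₀ (ε := ε / 4) (by positivity)
  have key : ∀ z : ℂ, 0 ≤ z.re → ‖centredXi z‖ ≤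
      Real.exp (ε * ‖z‖ ^ 2 + Real.log (C * Real.exp ε * (2 / ε + 1) + 1)) := by
    intro z hz
    have h1 := hb (1 / 2 + z) (by simp [hz])
    have h2 : ‖(1:ℂ) / 2 + z‖ ^ 2 ≤ 2 * ‖z‖ ^ 2 + 1 := by
      have := norm_add_le ((1:ℂ) / 2) z
      have h3 : ‖(1:ℂ) / 2‖ = 1 / 2 := by simp
      rw [h3] at this
      nlinarith [norm_nonneg ((1:ℂ) / 2 + z), norm_nonneg z, sq_nonneg (‖z‖ - 1 / 2)]
    have h3 : ‖z ^ 2 - 1 / 4‖ ≤ ‖z‖ ^ 2 + 1 := by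
      refine (norm_sub_le _ _).trans ?_
      rw [norm_pow]; norm_num
    have hlog : 0 < C * Real.exp ε * (2 / ε + 1) + 1 := by positivity
    rw [Real.exp_add, Real.exp_log hlog]
    set X := Real.exp (ε / 2 * ‖z‖ ^ 2) with hX
    have hX1 : 1 ≤ X := Real.one_le_exp (by positivity)
    have hXX : Real.exp (ε * ‖z‖ ^ 2) = X * X := by rw [hX, ← Real.exp_add]; ring_nf
    have h4 : ‖z‖ ^ 2 ≤ 2 / ε * X := by
      have := Real.add_one_le_exp (ε / 2 * ‖z‖ ^ 2)
      rw [← hX] at this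
      rw [div_mul_eq_mul_div, le_div_iff₀ hε]
      linarith
    have h5 : Real.exp (ε / 4 * ‖(1:ℂ) / 2 + z‖ ^ 2) ≤ Real.exp ε * X := by
      rw [hX, ← Real.exp_add, Real.exp_le_exp]
      nlinarith
    have h6 : ‖centredXi z‖ ≤ (‖z‖ ^ 2 + 1) * (C * (Real.exp ε * X)) + 1 := by
      refine (norm_add_le _ _).trans ?_
      rw [norm_mul, norm_one]
      gcongr
      exact h1.trans (by gcongr)
    rw [hXX]
    refine h6.trans ?_
    have h7 : (‖z‖ ^ 2 + 1) * (C * (Real.exp ε * X)) ≤ ((2 / ε + 1) * X) * (C * (Real.exp ε * X)) := by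
      gcongr; linarith
    nlinarith
  refine ⟨Real.log (C * Real.exp ε * (2 / ε + 1) + 1), fun z => ?_⟩
  rcases le_total 0 z.re with h | h
  · exact key z h
  · rw [← centredXi_neg, ← norm_neg z]
    exact key (-z) (by simpa using h)

theorem centredXi_zero_re (hRH : RiemannHypothesis) {z : ℂ} (hz : centredXi z = 0) : z.re = 0 := by
  set s := z + 1 / 2 with hs
  have hzs : z = s - 1 / 2 := by rw [hs]; ring
  have h0 : s ≠ 0 := by
    intro h
    rw [hzs, h] at hz
    unfold centredXi at hz
    norm_num at hz
  have h1 : s ≠ 1 := by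
    intro h
    rw [hzs, h] at hz
    unfold centredXi at hz
    norm_num at hz
  rw [hzs, centredXi_eq h0 h1] at hz
  have hL : completedRiemannZeta s = 0 := by
    rcases mul_eq_zero.1 hz with h | h
    · rcases mul_eq_zero.1 h with h | h
      · exact absurd h h0
      · exact absurd (sub_eq_zero.1 h) h1
    · exact h
  have hζ : riemannZeta s = 0 := by rw [riemannZeta_def_of_ne_zero h0, hL, zero_div]
  have hre := hRH s hζ ?_ h1
  · rw [hzs]; simp [hre]
  · rintro ⟨n, hn⟩
    have h2 : completedRiemannZeta (1 - s) = 0 := by rw [completedRiemannZeta_one_sub, hL]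
    have h3 : 1 ≤ (1 - s).re := by
      rw [hn]; simp; positivity
    have h4 : (1 - s) ≠ 0 := fun h => by rw [h] at h3; simp at h3; linarith
    have h5 : riemannZeta (1 - s) = 0 := by rw [riemannZeta_def_of_ne_zero h4, h2, zero_div]
    exact riemannZeta_ne_zero_of_one_le_re h3 h5

end

section

open Filter Topology Metric Set

theorem digamma_ofReal {x : ℝ} (hx : 0 < x) :
    Complex.digamma x = ((deriv Real.Gamma x / Real.Gamma x : ℝ) : ℂ) := by
  have hd : DifferentiableAt ℝ Real.Gamma x := Real.differentiableAt_Gamma fun m => by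
    have : (0:ℝ) ≤ m := m.cast_nonneg
    linarith
  have hc : DifferentiableAt ℂ Complex.Gamma x := Complex.differentiableAt_Gamma _ fun m h => by
    have h1 := congrArg Complex.re h
    simp at h1
    have : (0:ℝ) ≤ m := m.cast_nonneg
    linarith
  have h1 : HasDerivAt (fun t : ℝ => Complex.Gamma t) (deriv Complex.Gamma x) x :=
    hc.hasDerivAt.comp_ofReal
  have h2 : HasDerivAt (fun t : ℝ => ((Real.Gamma t : ℝ) : ℂ)) ((deriv Real.Gamma x : ℝ) : ℂ) x :=
    hd.hasDerivAt.ofReal_comp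
  have h3 : (fun t : ℝ => Complex.Gamma t) = fun t : ℝ => ((Real.Gamma t : ℝ) : ℂ) :=
    funext fun t => Complex.Gamma_ofReal t
  rw [h3] at h1
  rw [Complex.digamma_def, logDeriv_apply, h1.unique h2, Complex.Gamma_ofReal, Complex.ofReal_div]

theorem hasDerivAt_log_Gamma {x : ℝ} (hx : 0 < x) :
    HasDerivAt (Real.log ∘ Real.Gamma) (deriv Real.Gamma x / Real.Gamma x) x := by
  have hd : DifferentiableAt ℝ Real.Gamma x := Real.differentiableAt_Gamma fun m => by
    have : (0:ℝ) ≤ m := m.cast_nonneg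
    linarith
  exact hd.hasDerivAt.log (Real.Gamma_pos_of_pos hx).ne'

theorem slope_log_Gamma {x : ℝ} (hx : 0 < x) :
    slope (Real.log ∘ Real.Gamma) x (x + 1) = Real.log x := by
  rw [slope_def_field]
  simp only [Function.comp_apply]
  rw [Real.Gamma_add_one hx.ne', Real.log_mul hx.ne' (Real.Gamma_pos_of_pos hx).ne']
  ring

theorem digamma_re_le_log {x : ℝ} (hx : 0 < x) : (Complex.digamma x).re ≤ Real.log x := by
  rw [digamma_ofReal hx, Complex.ofReal_re, ← slope_log_Gamma hx]
  exact Real.convexOn_log_Gamma.le_slope_of_hasDerivAt (mem_Ioi.2 hx) (mem_Ioi.2 (by linarith))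
    (by linarith) (hasDerivAt_log_Gamma hx)

theorem log_le_digamma_re {x : ℝ} (hx : 0 < x) :
    Real.log x ≤ (Complex.digamma (x + 1 : ℝ)).re := by
  rw [digamma_ofReal (by linarith), Complex.ofReal_re, ← slope_log_Gamma hx]
  exact Real.convexOn_log_Gamma.slope_le_of_hasDerivAt (mem_Ioi.2 hx) (mem_Ioi.2 (by linarith))
    (by linarith) (hasDerivAt_log_Gamma (by linarith))

theorem digamma_add_natCast {x : ℝ} (hx : 0 < x) (n : ℕ) :
    Complex.digamma (x + n : ℝ) = Complex.digamma x + ∑ k ∈ Finset.range n, 1 / ((x : ℂ) + k) := by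
  induction n with
  | zero => simp
  | succ n ih =>
    have h := Complex.digamma_apply_add_one ((x + n : ℝ) : ℂ) fun m h => by
      have h1 := congrArg Complex.re h
      simp at h1
      have : (0:ℝ) ≤ m := m.cast_nonneg
      have : (0:ℝ) ≤ n := n.cast_nonneg
      linarith
    rw [Finset.sum_range_succ, ← add_assoc, ← ih]
    rw [show ((x + (n + 1 : ℕ) : ℝ) : ℂ) = ((x + n : ℝ) : ℂ) + 1 by push_cast; ring, h]
    push_cast
    rw [one_div]

theorem tendsto_digamma_shift_sub {x : ℝ} (hx : 0 < x) :
    Tendsto (fun n : ℕ => (Complex.digamma (x + n : ℝ)).re - Real.log n) atTop (𝓝 0) := by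
  have hlim : ∀ c : ℝ, Tendsto (fun n : ℕ => Real.log (c + n) - Real.log n) atTop (𝓝 0) := by
    intro c
    have h1 : Tendsto (fun n : ℕ => Real.log (c / n + 1)) atTop (𝓝 (Real.log (0 + 1))) :=
      ((tendsto_const_div_atTop_nhds_zero_nat c).add_const 1).log (by norm_num)
    rw [zero_add, Real.log_one] at h1
    refine h1.congr' ?_
    filter_upwards [eventually_gt_atTop 0, (tendsto_natCast_atTop_atTop (R := ℝ)).eventually_gt_atTop (-c)]
      with n hn hn2
    have hn' : (0:ℝ) < n := by exact_mod_cast hn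
    rw [← Real.log_div (by linarith) hn'.ne']
    congr 1
    field_simp
  refine tendsto_of_tendsto_of_tendsto_of_le_of_le' (hlim (x - 1)) (hlim x) ?_ ?_
  · filter_upwards [eventually_gt_atTop 0] with n hn
    have hn' : (1:ℝ) ≤ n := by exact_mod_cast hn
    have := log_le_digamma_re (x := x - 1 + n) (by linarith)
    rw [show x - 1 + (n:ℝ) + 1 = x + n by ring] at this
    linarith
  · filter_upwards with n
    have hn' : (0:ℝ) ≤ n := n.cast_nonneg
    have := digamma_re_le_log (x := x + n) (by linarith)
    linarith

theorem norm_digamma_term_le {z : ℂ} (hz : 0 ≤ z.re) (k : ℕ) :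
    ‖1 / ((k : ℂ) + 1) - 1 / ((k : ℂ) + 1 + z)‖ ≤ ‖z‖ * (1 / ((k : ℝ) + 1) ^ 2) := by
  have h1 : ((k : ℂ) + 1) ≠ 0 := Nat.cast_add_one_ne_zero k
  have h2 : (k : ℝ) + 1 ≤ ‖(k : ℂ) + 1 + z‖ := by
    have := Complex.re_le_norm ((k : ℂ) + 1 + z)
    simp at this
    linarith
  have h3 : (k : ℂ) + 1 + z ≠ 0 := norm_pos_iff.1 (lt_of_lt_of_le (by positivity) h2)
  have h4 : 1 / ((k : ℂ) + 1) - 1 / ((k : ℂ) + 1 + z) = z / (((k : ℂ) + 1) * ((k : ℂ) + 1 + z)) := by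
    field_simp; ring
  rw [h4, norm_div, norm_mul, mul_one_div]
  have h5 : ‖(k : ℂ) + 1‖ = (k : ℝ) + 1 := by
    rw [← Nat.cast_add_one, Complex.norm_natCast]; push_cast; rfl
  rw [h5, sq]
  gcongr

theorem summable_one_div_add_one_sq : Summable fun k : ℕ => 1 / ((k : ℝ) + 1) ^ 2 := by
  have := (summable_nat_add_iff 1).2 (Real.summable_one_div_nat_pow.2 one_lt_two)
  simpa using this

theorem summable_digamma_term {z : ℂ} (hz : 0 ≤ z.re) :
    Summable fun k : ℕ => 1 / ((k : ℂ) + 1) - 1 / ((k : ℂ) + 1 + z) :=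
  Summable.of_norm_bounded (summable_one_div_add_one_sq.mul_left ‖z‖) (norm_digamma_term_le hz)

theorem digamma_add_one_ofReal {x : ℝ} (hx : 0 < x) :
    Complex.digamma (x + 1) =
      Complex.digamma 1 + ∑' k : ℕ, (1 / ((k : ℂ) + 1) - 1 / ((k : ℂ) + 1 + x)) := by
  have hs := (summable_digamma_term (z := x) (by simpa using hx.le)).hasSum.tendsto_sum_nat
  have h2 : ∀ n : ℕ, ∑ k ∈ Finset.range n, (1 / ((k : ℂ) + 1) - 1 / ((k : ℂ) + 1 + x)) =
      (Complex.digamma (x + 1) - Complex.digamma 1) - (((Complex.digamma (x + 1 + n : ℝ)).re -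
        Real.log n - ((Complex.digamma (1 + n : ℝ)).re - Real.log n) : ℝ) : ℂ) := by
    intro n
    have hn : (0:ℝ) ≤ n := n.cast_nonneg
    have e1 := digamma_add_natCast (x := x + 1) (by linarith) n
    have e2 := digamma_add_natCast (x := 1) one_pos n
    have e3 : ∀ y : ℝ, 0 < y → (((Complex.digamma y).re : ℝ) : ℂ) = Complex.digamma y := by
      intro y hy; rw [digamma_ofReal hy, Complex.ofReal_re]
    have e4 := e3 (x + 1 + n) (by linarith)
    have e5 := e3 (1 + n) (by linarith)
    rw [Finset.sum_sub_distrib]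
    have e6 : ∑ k ∈ Finset.range n, 1 / ((k : ℂ) + 1) = ∑ k ∈ Finset.range n, 1 / (((1:ℝ) : ℂ) + k) :=
      Finset.sum_congr rfl fun k _ => by push_cast; ring_nf
    have e7 : ∑ k ∈ Finset.range n, 1 / ((k : ℂ) + 1 + x) =
        ∑ k ∈ Finset.range n, 1 / (((x + 1 : ℝ) : ℂ) + k) :=
      Finset.sum_congr rfl fun k _ => by push_cast; ring_nf
    rw [e6, e7]
    push_cast at *
    rw [e4, e5, e1, e2]
    ring
  have h3 : Tendsto (fun n : ℕ => (Complex.digamma (x + 1 + n : ℝ)).re -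
        Real.log n - ((Complex.digamma (1 + n : ℝ)).re - Real.log n)) atTop (𝓝 (0 - 0)) :=
    (tendsto_digamma_shift_sub (by linarith)).sub (tendsto_digamma_shift_sub one_pos)
  have h4 := tendsto_nhds_unique hs ((tendsto_const_nhds.sub
    ((Complex.continuous_ofReal.tendsto _).comp h3)).congr fun n => (h2 n).symm)
  rw [h4]; simp

theorem digamma_add_one_eq_tsum {z : ℂ} (hz : 0 < z.re) :
    Complex.digamma (z + 1) =
      Complex.digamma 1 + ∑' k : ℕ, (1 / ((k : ℂ) + 1) - 1 / ((k : ℂ) + 1 + z)) := by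
  set R := ‖z‖ + 2
  set U : Set ℂ := {w | 0 < w.re} ∩ ball 0 R
  have hUo : IsOpen U := (isOpen_lt continuous_const Complex.continuous_re).inter isOpen_ball
  have hUc : IsPreconnected U :=
    ((convex_halfSpace_re_gt 0).inter (convex_ball 0 R)).isPreconnected
  have hzU : z ∈ U := ⟨hz, by simp [R]⟩
  have h1U : (1:ℂ) ∈ U := ⟨by simp, by simp [R]; linarith [norm_nonneg z]⟩
  have hf : DifferentiableOn ℂ (fun w => Complex.digamma (w + 1)) U := by
    intro w hw
    have hw0 : 0 < w.re := hw.1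
    have hne : ∀ m : ℕ, w + 1 ≠ -m := fun m h => by
      have h1 := congrArg Complex.re h
      simp at h1
      have : (0:ℝ) ≤ m := m.cast_nonneg
      linarith
    have hG : DifferentiableAt ℂ Complex.Gamma (w + 1) := Complex.differentiableAt_Gamma _ hne
    have ho : IsOpen {v : ℂ | 0 < v.re} := isOpen_lt continuous_const Complex.continuous_re
    have hGo : DifferentiableOn ℂ Complex.Gamma {v : ℂ | 0 < v.re} := fun v hv =>
      (Complex.differentiableAt_Gamma _ fun m h => by
        have h1 := congrArg Complex.re h
        simp at h1
        have : (0:ℝ) ≤ m := m.cast_nonneg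
        have hv : 0 < v.re := hv
        linarith).differentiableWithinAt
    have hG' : DifferentiableAt ℂ (deriv Complex.Gamma) (w + 1) :=
      (hGo.deriv ho).differentiableAt (ho.mem_nhds (by simp; linarith))
    have hdi : DifferentiableAt ℂ Complex.digamma (w + 1) := by
      rw [Complex.digamma_def]
      exact hG'.div hG (Complex.Gamma_ne_zero hne)
    exact (hdi.comp w (by fun_prop : DifferentiableAt ℂ (fun w : ℂ => w + 1) w)).differentiableWithinAt
  have hg : DifferentiableOn ℂ (fun w : ℂ => Complex.digamma 1 +
      ∑' k : ℕ, (1 / ((k : ℂ) + 1) - 1 / ((k : ℂ) + 1 + w))) U := by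
    refine (differentiableOn_const _).add ?_
    refine Complex.differentiableOn_tsum_of_summable_norm
      (u := fun k : ℕ => R * (1 / ((k : ℝ) + 1) ^ 2))
      (summable_one_div_add_one_sq.mul_left R) (fun k w hw => ?_) hUo fun k w hw => ?_
    · have hw0 : 0 < w.re := hw.1
      have : (k : ℂ) + 1 + w ≠ 0 := fun h => by
        have h1 := congrArg Complex.re h
        simp at h1
        have : (0:ℝ) ≤ k := k.cast_nonneg
        linarith
      exact DifferentiableAt.differentiableWithinAt (by fun_prop (disch := assumption))
    · refine (norm_digamma_term_le (le_of_lt hw.1) k).trans ?_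
      have : ‖w‖ ≤ R := (mem_ball_zero_iff.1 hw.2).le
      gcongr
  refine (hf.analyticOnNhd hUo).eqOn_of_preconnected_of_frequently_eq (hg.analyticOnNhd hUo) hUc
    h1U ?_ hzU
  have hseq : Tendsto (fun n : ℕ => ((1 + 1 / ((n : ℝ) + 1) : ℝ) : ℂ)) atTop (𝓝[≠] 1) := by
    refine tendsto_nhdsWithin_iff.2 ⟨?_, ?_⟩
    · have : Tendsto (fun n : ℕ => 1 + 1 / ((n : ℝ) + 1)) atTop (𝓝 (1 + 0)) :=
        tendsto_const_nhds.add tendsto_one_div_add_atTop_nhds_zero_nat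
      have h : Tendsto (fun n : ℕ => ((1 + 1 / ((n : ℝ) + 1) : ℝ) : ℂ)) atTop
          (𝓝 ((1 + 0 : ℝ) : ℂ)) := (Complex.continuous_ofReal.tendsto _).comp this
      simpa only [add_zero, Complex.ofReal_one] using h
    · refine Eventually.of_forall fun n h => ?_
      have h1 : (1 + 1 / ((n : ℝ) + 1)) = 1 := Complex.ofReal_eq_one.1 h
      have : 0 < 1 / ((n : ℝ) + 1) := by positivity
      linarith
  refine hseq.frequently (Eventually.frequently (Eventually.of_forall fun n => ?_))
  exact digamma_add_one_ofReal (by positivity)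

end

section

open Filter Topology Metric Set

/-- The ordinates of the zeros of the Riemann xi function, assuming the Riemann hypothesis. -/
abbrev XiZero := {γ : ℝ // centredXi (Complex.I * γ) = 0}

/-- The multiplicity of a zero of the Riemann xi function. -/
noncomputable def xiMult (γ : XiZero) : ℕ := analyticOrderNatAt centredXi (Complex.I * (γ : ℝ))

theorem hasSum_xiZero (hRH : RiemannHypothesis) {z : ℂ} (hz : 0 < z.re) :
    HasSum (fun γ : XiZero => (xiMult γ : ℂ) * (z / (z ^ 2 + ((γ : ℝ) : ℂ) ^ 2)))
      (logDeriv centredXi z) :=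
  hasSum_logDeriv_of_even differentiable_centredXi centredXi_neg
    (fun _ h => centredXi_zero_re hRH h) (fun _ h => centredXi_growth h) hz

theorem logDeriv_centredXi {s : ℂ} (hs : 1 < s.re) :
    logDeriv centredXi (s - 1 / 2) = 1 / s + 1 / (s - 1) - Real.log Real.pi / 2 +
      Complex.digamma (s / 2) / 2 + deriv riemannZeta s / riemannZeta s := by
  have ho : IsOpen {w : ℂ | 1 < w.re} := isOpen_lt continuous_const Complex.continuous_re
  have hne0 : ∀ w : ℂ, 1 < w.re → w ≠ 0 := fun w hw h => by rw [h] at hw; simp at hw; linarith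
  have hne1 : ∀ w : ℂ, 1 < w.re → w ≠ 1 := fun w hw h => by rw [h] at hw; simp at hw
  have heq : ∀ w : ℂ, 1 < w.re → centredXi (w - 1 / 2) =
      w * (w - 1) * ((Real.pi : ℂ) ^ (-w / 2) * Complex.Gamma (w / 2)) * riemannZeta w := by
    intro w hw
    rw [centredXi_eq (hne0 w hw) (hne1 w hw), riemannZeta_def_of_ne_zero (hne0 w hw),
      ← Complex.Gammaℝ_def]
    have : Complex.Gammaℝ w ≠ 0 := Complex.Gammaℝ_ne_zero_of_re_pos (by linarith)
    field_simp
  have hG : ∀ m : ℕ, s / 2 ≠ -m := fun m h => by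
    have h1 := congrArg Complex.re h
    simp at h1
    have : (0:ℝ) ≤ m := m.cast_nonneg
    linarith
  have hpi : (Real.pi : ℂ) ≠ 0 := by exact_mod_cast Real.pi_ne_zero
  have hs0 := hne0 s hs
  have hs1 : s - 1 ≠ 0 := sub_ne_zero.2 (hne1 s hs)
  have hz0 : riemannZeta s ≠ 0 := riemannZeta_ne_zero_of_one_le_re hs.le
  have hG0 := Complex.Gamma_ne_zero hG
  have hp0 : (Real.pi : ℂ) ^ (-s / 2) ≠ 0 := by simp [Complex.cpow_eq_zero_iff, hpi]
  have dG : HasDerivAt (fun w : ℂ => Complex.Gamma (w / 2))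
      (deriv Complex.Gamma (s / 2) * (1 / 2)) s :=
    (Complex.differentiableAt_Gamma _ hG).hasDerivAt.comp s ((hasDerivAt_id s).div_const 2)
  have dP : HasDerivAt (fun w : ℂ => (Real.pi : ℂ) ^ (-w / 2))
      ((Real.pi : ℂ) ^ (-s / 2) * Complex.log Real.pi * (-1 / 2)) s :=
    (((hasDerivAt_id s).neg).div_const 2).const_cpow (Or.inl hpi)
  have dz : HasDerivAt riemannZeta (deriv riemannZeta s) s :=
    (differentiableAt_riemannZeta (hne1 s hs)).hasDerivAt
  have dA : HasDerivAt (fun w : ℂ => w * (w - 1)) (1 * (s - 1) + s * 1) s :=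
    (hasDerivAt_id s).mul ((hasDerivAt_id s).sub_const 1)
  have d1 := ((dA.mul (dP.mul dG)).mul dz)
  have d2 : HasDerivAt centredXi (deriv centredXi (s - 1 / 2)) (s - 1 / 2) :=
    (differentiable_centredXi _).hasDerivAt
  have d3 := d2.comp s ((hasDerivAt_id s).sub_const (1 / 2))
  have d4 : (centredXi ∘ fun w : ℂ => id w - 1 / 2) =ᶠ[𝓝 s] fun w => w * (w - 1) *
      ((Real.pi : ℂ) ^ (-w / 2) * Complex.Gamma (w / 2)) * riemannZeta w := by
    filter_upwards [ho.mem_nhds hs] with w hw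
    exact heq w hw
  have d5 := (d3.congr_of_eventuallyEq d4.symm).unique d1
  rw [mul_one] at d5
  rw [logDeriv_apply, d5, heq s hs, Complex.digamma_def, logDeriv_apply, Complex.ofReal_log Real.pi_nonneg]
  simp only [Pi.mul_apply]
  field_simp
  ring

theorem neg_logDeriv_zeta_eq {s : ℂ} (hs : 1 < s.re) :
    -deriv riemannZeta s / riemannZeta s = 1 / (s - 1) +
      (Complex.digamma 1 / 2 - Real.log Real.pi / 2) +
      ∑' k : ℕ, (1 / ((k : ℂ) + 1) - 1 / ((k : ℂ) + 1 + s / 2)) / 2 -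
      logDeriv centredXi (s - 1 / 2) := by
  have hs2 : 0 < (s / 2).re := by simp; linarith
  have h1 := digamma_add_one_eq_tsum hs2
  rw [Complex.digamma_apply_add_one _ fun m h => by
    rw [h] at hs2
    simp at hs2
    have : (0:ℝ) ≤ m := m.cast_nonneg
    linarith] at h1
  rw [logDeriv_centredXi hs, tsum_div_const]
  have h2 : (s / 2)⁻¹ = 2 * (1 / s) := by
    rw [inv_div]; ring
  rw [h2] at h1
  linear_combination h1 / 2

theorem re_deriv_zeta_div_nonpos {x : ℝ} (hx : 1 < x) :
    (deriv riemannZeta x / riemannZeta x).re ≤ 0 := by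
  have h := ArithmeticFunction.LSeries_vonMangoldt_eq_deriv_riemannZeta_div (s := x) (by simpa using hx)
  have h2 : deriv riemannZeta x / riemannZeta x =
      -LSeries (fun n => (ArithmeticFunction.vonMangoldt n : ℂ)) x := by
    rw [h]; ring
  rw [h2, Complex.neg_re, neg_nonpos, LSeries, Complex.re_tsum
    (ArithmeticFunction.LSeriesSummable_vonMangoldt (by simpa using hx))]
  refine tsum_nonneg fun n => ?_
  rw [LSeries.term_def]
  split_ifs with hn
  · simp
  · have : ((n:ℂ) ^ (x:ℂ)) = (((n:ℝ) ^ x : ℝ) : ℂ) := by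
      rw [Complex.ofReal_cpow n.cast_nonneg]; simp
    rw [this, ← Complex.ofReal_div, Complex.ofReal_re]
    exact div_nonneg ArithmeticFunction.vonMangoldt_nonneg (by positivity)

theorem hasSum_xiZero_real (hRH : RiemannHypothesis) {b : ℝ} (hb : 0 < b) :
    HasSum (fun γ : XiZero => (xiMult γ : ℝ) * (b / (b ^ 2 + (γ : ℝ) ^ 2)))
      (logDeriv centredXi b).re := by
  have := Complex.hasSum_re (hasSum_xiZero hRH (z := b) (by simpa using hb))
  have h : ∀ γ : XiZero, ((xiMult γ : ℂ) * ((b : ℂ) / ((b : ℂ) ^ 2 + ((γ : ℝ) : ℂ) ^ 2))).re =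
      (xiMult γ : ℝ) * (b / (b ^ 2 + (γ : ℝ) ^ 2)) := by
    intro γ
    rw [← Complex.ofReal_re ((xiMult γ : ℝ) * (b / (b ^ 2 + (γ : ℝ) ^ 2)))]
    push_cast; rfl
  simpa only [h] using this

theorem logDeriv_centredXi_re_le {b : ℝ} (hb : 1 / 2 < b) :
    (logDeriv centredXi b).re ≤ Real.log ((b + 1 / 2) / (2 * Real.pi)) / 2 + 1 / (b + 1 / 2) +
      1 / (b - 1 / 2) := by
  have h := logDeriv_centredXi (s := ((b + 1 / 2 : ℝ) : ℂ)) (by simp; linarith)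
  have h1 : ((b + 1 / 2 : ℝ) : ℂ) - 1 / 2 = b := by push_cast; ring
  have h2 := re_deriv_zeta_div_nonpos (x := b + 1 / 2) (by linarith)
  have h3 := digamma_re_le_log (x := (b + 1 / 2) / 2) (by linarith)
  rw [h1] at h
  rw [h]
  have e1 : (1 / ((b + 1 / 2 : ℝ) : ℂ) + 1 / (((b + 1 / 2 : ℝ) : ℂ) - 1) - Real.log Real.pi / 2 +
      Complex.digamma (((b + 1 / 2 : ℝ) : ℂ) / 2) / 2).re = 1 / (b + 1 / 2) + 1 / (b - 1 / 2) -
      Real.log Real.pi / 2 + (Complex.digamma ((b + 1 / 2) / 2 : ℝ)).re / 2 := by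
    have e2 : (1 / ((b + 1 / 2 : ℝ) : ℂ) + 1 / (((b + 1 / 2 : ℝ) : ℂ) - 1) - Real.log Real.pi / 2) =
      ((1 / (b + 1 / 2) + 1 / (b - 1 / 2) - Real.log Real.pi / 2 : ℝ) : ℂ) := by
      push_cast; ring
    rw [e2, Complex.add_re, Complex.ofReal_re, Complex.div_ofNat_re]
    push_cast; rfl
  rw [Complex.add_re, e1]
  have h4 : Real.log ((b + 1 / 2) / (2 * Real.pi)) = Real.log ((b + 1 / 2) / 2) - Real.log Real.pi := by
    rw [← div_div, Real.log_div (by linarith) Real.pi_ne_zero]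
  rw [h4]; linarith

end

section

open Filter Topology Metric Set MeasureTheory

/-- `F` is the Laplace transform of `f` along the line `Re s = 2`, where `f` is continuous on
`(0, ∞)` and bounded by a multiple of `exp (3 u / 2)`. -/
structure HasLaplace (f : ℝ → ℂ) (F : ℂ → ℂ) : Prop where
  cont : ContinuousOn f (Ioi 0)
  bound : ∃ C : ℝ, ∀ u > 0, ‖f u‖ ≤ C * Real.exp (3 / 2 * u)
  integral : ∀ s : ℂ, s.re = 2 → ∫ u in Ioi (0 : ℝ), Complex.exp (-s * u) * f u = F s

theorem norm_exp_mul_le_of_le {f : ℂ} {s : ℂ} (hs : s.re = 2) {C u : ℝ}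
    (h : ‖f‖ ≤ C * Real.exp (3 / 2 * u)) :
    ‖Complex.exp (-s * u) * f‖ ≤ C * Real.exp (-(1 / 2) * u) := by
  have e : Real.exp (-2 * u) * (C * Real.exp (3 / 2 * u)) = C * Real.exp (-(1 / 2) * u) := by
    rw [mul_left_comm, ← Real.exp_add]; ring_nf
  rw [norm_mul, Complex.norm_exp, ← e]
  have : (-s * (u : ℂ)).re = -2 * u := by simp [hs]
  rw [this]
  gcongr

theorem integrableOn_laplace {f : ℝ → ℂ} (hc : ContinuousOn f (Ioi 0)) {C : ℝ}
    (hb : ∀ u > 0, ‖f u‖ ≤ C * Real.exp (3 / 2 * u)) {s : ℂ} (hs : s.re = 2) :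
    IntegrableOn (fun u : ℝ => Complex.exp (-s * u) * f u) (Ioi 0) := by
  refine Integrable.mono' (g := fun u => C * Real.exp (-(1 / 2) * u))
    ((integrableOn_exp_mul_Ioi (by norm_num) 0).const_mul C) ?_ ?_
  · refine ContinuousOn.aestronglyMeasurable ?_ measurableSet_Ioi
    exact (by fun_prop : Continuous fun u : ℝ => Complex.exp (-s * u)).continuousOn.mul hc
  · exact (ae_restrict_mem measurableSet_Ioi).mono fun u hu => norm_exp_mul_le_of_le hs (hb u hu)

namespace HasLaplace

variable {f g : ℝ → ℂ} {F G : ℂ → ℂ}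

theorem integrableOn (h : HasLaplace f F) {s : ℂ} (hs : s.re = 2) :
    IntegrableOn (fun u : ℝ => Complex.exp (-s * u) * f u) (Ioi 0) := by
  obtain ⟨C, hC⟩ := h.bound
  exact integrableOn_laplace h.cont hC hs

theorem add (hf : HasLaplace f F) (hg : HasLaplace g G) :
    HasLaplace (fun u => f u + g u) (fun s => F s + G s) := by
  refine ⟨hf.cont.add hg.cont, ?_, fun s hs => ?_⟩
  · obtain ⟨C, hC⟩ := hf.bound
    obtain ⟨D, hD⟩ := hg.bound
    refine ⟨C + D, fun u hu => (norm_add_le _ _).trans ?_⟩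
    rw [add_mul]
    exact add_le_add (hC u hu) (hD u hu)
  · simp_rw [mul_add]
    rw [integral_add (hf.integrableOn hs) (hg.integrableOn hs), hf.integral s hs, hg.integral s hs]

theorem const_mul (c : ℂ) (hf : HasLaplace f F) :
    HasLaplace (fun u => c * f u) (fun s => c * F s) := by
  refine ⟨hf.cont.const_mul c, ?_, fun s hs => ?_⟩
  · obtain ⟨C, hC⟩ := hf.bound
    refine ⟨‖c‖ * C, fun u hu => ?_⟩
    rw [norm_mul, mul_assoc]
    exact mul_le_mul_of_nonneg_left (hC u hu) (norm_nonneg _)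
  · simp_rw [mul_left_comm _ c]
    rw [integral_const_mul, hf.integral s hs]

theorem sub (hf : HasLaplace f F) (hg : HasLaplace g G) :
    HasLaplace (fun u => f u - g u) (fun s => F s - G s) := by
  have := hf.add (hg.const_mul (-1))
  simpa [sub_eq_add_neg] using this

theorem congr {f' : ℝ → ℂ} {F' : ℂ → ℂ} (hf : HasLaplace f F) (h : ∀ u > 0, f' u = f u)
    (H : ∀ s : ℂ, s.re = 2 → F' s = F s) : HasLaplace f' F' := by
  refine ⟨hf.cont.congr fun u hu => h u hu, ?_, fun s hs => ?_⟩
  · obtain ⟨C, hC⟩ := hf.bound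
    exact ⟨C, fun u hu => by rw [h u hu]; exact hC u hu⟩
  · rw [H s hs, ← hf.integral s hs]
    exact setIntegral_congr_fun measurableSet_Ioi fun u hu => by simp only [h u hu]

theorem tsum {ι : Type*} [Countable ι] {f : ι → ℝ → ℂ} {F : ι → ℂ → ℂ}
    (hf : ∀ i, HasLaplace (f i) (F i)) {a : ι → ℝ} (ha : Summable a)
    (hb : ∀ i, ∀ u > 0, ‖f i u‖ ≤ a i * Real.exp (3 / 2 * u)) :
    HasLaplace (fun u => ∑' i, f i u) (fun s => ∑' i, F i s) := by
  refine ⟨?_, ⟨∑' i, a i, fun u hu => ?_⟩, fun s hs => ?_⟩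
  · intro x hx
    have hx' : (0 : ℝ) < x := hx
    have h1 : ContinuousOn (fun u => ∑' i, f i u) (Ioo 0 (x + 1)) := by
      refine continuousOn_tsum (u := fun i => a i * Real.exp (3 / 2 * (x + 1)))
        (fun i => (hf i).cont.mono Ioo_subset_Ioi_self) (ha.mul_right _) fun i u hu => ?_
      refine (hb i u hu.1).trans ?_
      have : 0 ≤ a i := by
        have := (norm_nonneg _).trans (hb i u hu.1)
        exact nonneg_of_mul_nonneg_left this (Real.exp_pos _)
      have := hu.2.le
      gcongr
    exact (h1.continuousAt (Ioo_mem_nhds hx' (by linarith))).continuousWithinAt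
  · rw [← tsum_mul_right]
    exact tsum_of_norm_bounded (ha.mul_right _).hasSum fun i => hb i u hu
  · have h2 := hasSum_integral_of_summable_integral_norm (μ := volume.restrict (Ioi (0 : ℝ)))
      (F := fun i (u : ℝ) => Complex.exp (-s * u) * f i u) (fun i => (hf i).integrableOn hs) ?_
    · simp_rw [tsum_mul_left] at h2
      rw [← h2.tsum_eq]
      exact tsum_congr fun i => (hf i).integral s hs
    · have hI : IntegrableOn (fun u : ℝ => Real.exp (-(1 / 2) * u)) (Ioi 0) :=
        integrableOn_exp_mul_Ioi (by norm_num) 0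
      refine Summable.of_nonneg_of_le (fun i => integral_nonneg fun _ => norm_nonneg _)
        (fun i => ?_) (ha.mul_right (∫ u in Ioi (0 : ℝ), Real.exp (-(1 / 2) * u)))
      rw [← integral_const_mul]
      exact setIntegral_mono_on ((hf i).integrableOn hs).norm (hI.const_mul _) measurableSet_Ioi
        fun u hu => norm_exp_mul_le_of_le hs (hb i u hu)

open scoped FourierTransform in
theorem eq_zero (hf : HasLaplace f 0) {u : ℝ} (hu : 0 < u) : f u = 0 := by
  set g : ℝ → ℂ := (Ioi (0 : ℝ)).indicator fun u => Complex.exp (-2 * u) * f u with hg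
  have hint : Integrable g :=
    (integrable_indicator_iff measurableSet_Ioi).2 (hf.integrableOn (s := 2) (by simp))
  have hF : 𝓕 g = 0 := by
    ext w
    rw [Real.fourier_real_eq_integral_exp_smul]
    have h := hf.integral (2 + 2 * Real.pi * w * Complex.I) (by simp)
    rw [Pi.zero_apply] at h ⊢
    rw [← h, ← integral_indicator measurableSet_Ioi]
    refine integral_congr_ae (Eventually.of_forall fun v => ?_)
    by_cases hv : v ∈ Ioi (0 : ℝ)
    · simp only [hg, indicator_of_mem hv, smul_eq_mul]
      rw [← mul_assoc, ← Complex.exp_add]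
      congr 2
      push_cast
      ring
    · simp [hg, indicator_of_notMem hv]
  have hc : ContinuousAt g u := by
    have h1 : ContinuousAt (fun u : ℝ => Complex.exp (-2 * u) * f u) u :=
      ((by fun_prop : Continuous fun u : ℝ => Complex.exp (-2 * u)).continuousOn.mul
        hf.cont).continuousAt (Ioi_mem_nhds hu)
    refine h1.congr ?_
    filter_upwards [Ioi_mem_nhds hu] with v hv
    rw [hg, indicator_of_mem hv]
  have key := hint.fourierInv_fourier_eq (by rw [hF]; exact integrable_zero _ _ _) hc
  rw [hF] at key
  have h0 : 𝓕⁻ (0 : ℝ → ℂ) u = 0 := by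
    rw [Real.fourierInv_eq']; simp
  rw [h0, hg, indicator_of_mem (show u ∈ Ioi (0 : ℝ) from hu)] at key
  exact (mul_eq_zero.1 key.symm).resolve_left (Complex.exp_ne_zero _)

theorem unique (hf : HasLaplace f F) (hg : HasLaplace g F) {u : ℝ} (hu : 0 < u) : f u = g u := by
  refine sub_eq_zero.1 (eq_zero (f := fun u => f u - g u) ?_ hu)
  exact (hf.sub hg).congr (fun _ _ => rfl) fun s _ => by simp

end HasLaplace

theorem hasLaplace_exp {a : ℂ} (ha : a.re ≤ 3 / 2) :
    HasLaplace (fun u => Complex.exp (a * u)) (fun s => 1 / (s - a)) := by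
  refine ⟨by fun_prop, ⟨1, fun u hu => ?_⟩, fun s hs => ?_⟩
  · rw [Complex.norm_exp, one_mul]
    gcongr
    simp only [Complex.mul_re, Complex.ofReal_re, Complex.ofReal_im, mul_zero, sub_zero]
    gcongr
  · have h : (a - s).re < 0 := by simp [hs]; linarith
    have h' : s - a ≠ 0 := fun h0 => by
      have : (a - s).re = 0 := by rw [← neg_sub, h0]; simp
      linarith
    have := integral_exp_mul_complex_Ioi h 0
    simp_rw [← Complex.exp_add, ← add_mul]
    rw [show -s + a = a - s by ring, this]
    rw [← neg_sub s a, neg_div_neg_eq]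
    simp

theorem hasLaplace_max_sub {c : ℝ} (hc : 0 ≤ c) :
    HasLaplace (fun u => ((max (u - c) 0 : ℝ) : ℂ)) (fun s => Complex.exp (-c * s) / s ^ 2) := by
  have hcont : Continuous fun u : ℝ => ((max (u - c) 0 : ℝ) : ℂ) := by fun_prop
  have hb : ∀ u > (0 : ℝ), ‖((max (u - c) 0 : ℝ) : ℂ)‖ ≤ 1 * Real.exp (3 / 2 * u) := by
    intro u hu
    rw [Complex.norm_real, Real.norm_of_nonneg (le_max_right _ _), one_mul]
    refine max_le ?_ (Real.exp_pos _).le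
    have := Real.add_one_le_exp (3 / 2 * u)
    linarith
  refine ⟨hcont.continuousOn, ⟨1, hb⟩, fun s hs => ?_⟩
  have hs0 : s ≠ 0 := fun h => by simp [h] at hs
  have hsub : Ioi c ⊆ Ioi (0 : ℝ) := Ioi_subset_Ioi hc
  have hI := integrableOn_laplace hcont.continuousOn hb hs
  rw [setIntegral_eq_of_subset_of_forall_sdiff_eq_zero measurableSet_Ioi hsub]
  · have hd : ∀ u ∈ Ioi c, HasDerivAt
        (fun u : ℝ => -(((u : ℂ) - c) / s + 1 / s ^ 2) * Complex.exp (-s * u))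
        (Complex.exp (-s * u) * ((max (u - c) 0 : ℝ) : ℂ)) u := by
      intro u hu
      have hu' : c < u := hu
      have h1 : HasDerivAt (fun u : ℝ => (u : ℂ)) 1 u := Complex.ofRealCLM.hasDerivAt
      have h2 := (((h1.sub_const (c : ℂ)).div_const s).add_const (1 / s ^ 2)).neg.mul
        ((h1.const_mul (-s)).cexp)
      refine HasDerivAt.congr_deriv h2 ?_
      rw [max_eq_left (by linarith), Pi.neg_apply]
      push_cast
      field_simp
      ring
    have hlim : Tendsto (fun u : ℝ => -(((u : ℂ) - c) / s + 1 / s ^ 2) * Complex.exp (-s * u))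
        atTop (𝓝 0) := by
      have e1 : Tendsto (fun u : ℝ => u * Real.exp (-2 * u)) atTop (𝓝 0) := by
        have := Real.tendsto_pow_mul_exp_neg_atTop_nhds_zero 1
        refine squeeze_zero_norm' ?_ (by simpa using this)
        filter_upwards [eventually_ge_atTop 0] with u hu
        rw [Real.norm_of_nonneg (by positivity)]
        gcongr
        linarith
      have e2 : Tendsto (fun u : ℝ => Real.exp (-2 * u)) atTop (𝓝 0) := by
        refine Real.tendsto_exp_atBot.comp ?_
        exact tendsto_id.const_mul_atTop_of_neg (by norm_num)
      have e3 := (e1.mul_const (1 / ‖s‖)).add (e2.const_mul (‖-(c : ℂ) / s + 1 / s ^ 2‖))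
      simp only [zero_mul, mul_zero, add_zero] at e3
      refine squeeze_zero_norm' ?_ e3
      filter_upwards [eventually_ge_atTop 0] with u hu
      have hre : (-s * (u : ℂ)).re = -2 * u := by simp [hs]
      rw [norm_mul, norm_neg, Complex.norm_exp, hre]
      have : ‖((u : ℂ) - c) / s + 1 / s ^ 2‖ ≤ u * (1 / ‖s‖) + ‖-(c : ℂ) / s + 1 / s ^ 2‖ := by
        have e : ((u : ℂ) - c) / s + 1 / s ^ 2 = (u : ℂ) * (1 / s) + (-(c : ℂ) / s + 1 / s ^ 2) := by
          ring
        rw [e]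
        refine (norm_add_le _ _).trans (le_of_eq ?_)
        rw [norm_mul, norm_div, norm_one, Complex.norm_real, Real.norm_of_nonneg hu]
      calc _ ≤ (u * (1 / ‖s‖) + ‖-(c : ℂ) / s + 1 / s ^ 2‖) * Real.exp (-2 * u) := by gcongr
        _ = _ := by ring
    have hcw : ContinuousWithinAt
        (fun u : ℝ => -(((u : ℂ) - c) / s + 1 / s ^ 2) * Complex.exp (-s * u)) (Ici c) c := by
      apply Continuous.continuousWithinAt
      fun_prop
    rw [integral_Ioi_of_hasDerivAt_of_tendsto hcw hd (hI.mono_set hsub) hlim]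
    simp
    field_simp
  · intro u hu
    have : max (u - c) 0 = 0 := max_eq_right (by
      have := hu.2
      simp only [mem_Ioi, not_lt] at this
      linarith)
    simp [this]

theorem hasLaplace_id : HasLaplace (fun u => (u : ℂ)) (fun s => 1 / s ^ 2) :=
  (hasLaplace_max_sub le_rfl).congr
    (fun u hu => by rw [sub_zero, max_eq_left hu.le]) fun s _ => by simp

end

section

open Filter Topology Metric Set MeasureTheory
open ArithmeticFunction (vonMangoldt)

/-- The integrated Chebyshev function `∑ Λ(n) (u - log n)` over `n ≤ exp u`. -/
noncomputable def psiIntegral (u : ℝ) : ℝ :=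
  ∑' n : ℕ, vonMangoldt n * max (u - Real.log n) 0

theorem summable_vonMangoldt_rpow : Summable fun n : ℕ => vonMangoldt n / (n : ℝ) ^ (3 / 2 : ℝ) := by
  have h := ArithmeticFunction.LSeriesSummable_vonMangoldt (s := (3 / 2 : ℝ))
    (by rw [Complex.ofReal_re]; norm_num)
  refine h.norm.congr fun n => ?_
  rw [LSeries.term_def]
  split_ifs with hn
  · simp [hn]
  · rw [norm_div, Complex.norm_natCast_cpow_of_pos (Nat.pos_of_ne_zero hn), Complex.norm_real,
      Real.norm_of_nonneg ArithmeticFunction.vonMangoldt_nonneg, Complex.ofReal_re]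

theorem vonMangoldt_mul_max_le (n : ℕ) (u : ℝ) :
    vonMangoldt n * max (u - Real.log n) 0 ≤
      vonMangoldt n / (n : ℝ) ^ (3 / 2 : ℝ) * Real.exp (3 / 2 * u) := by
  rcases Nat.eq_zero_or_pos n with rfl | hn
  · simp
  have hn' : (0 : ℝ) < n := by exact_mod_cast hn
  have e : vonMangoldt n / (n : ℝ) ^ (3 / 2 : ℝ) * Real.exp (3 / 2 * u) =
      vonMangoldt n * Real.exp (3 / 2 * (u - Real.log n)) := by
    rw [mul_sub, Real.exp_sub, Real.rpow_def_of_pos hn', mul_comm (3 / 2) (Real.log n)]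
    ring
  rw [e]
  refine mul_le_mul_of_nonneg_left (max_le ?_ (Real.exp_pos _).le)
    ArithmeticFunction.vonMangoldt_nonneg
  rcases le_total (u - Real.log n) 0 with h | h
  · exact h.trans (Real.exp_pos _).le
  · have := Real.add_one_le_exp (3 / 2 * (u - Real.log n))
    linarith

theorem summable_psiIntegral (u : ℝ) :
    Summable fun n : ℕ => vonMangoldt n * max (u - Real.log n) 0 :=
  Summable.of_nonneg_of_le (fun _ => mul_nonneg ArithmeticFunction.vonMangoldt_nonneg
    (le_max_right _ _)) (fun n => vonMangoldt_mul_max_le n u) (summable_vonMangoldt_rpow.mul_right _)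

theorem hasLaplace_psiIntegral :
    HasLaplace (fun u => (psiIntegral u : ℂ))
      (fun s => (-deriv riemannZeta s / riemannZeta s) / s ^ 2) := by
  have h := HasLaplace.tsum (fun n : ℕ => ((hasLaplace_max_sub
    (Real.log_natCast_nonneg n)).const_mul (vonMangoldt n : ℂ))) summable_vonMangoldt_rpow ?_
  · refine h.congr (fun u _ => ?_) fun s hs => ?_
    · rw [psiIntegral, Complex.ofReal_tsum]
      push_cast
      rfl
    · rw [← ArithmeticFunction.LSeries_vonMangoldt_eq_deriv_riemannZeta_div (by rw [hs]; norm_num),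
        LSeries, ← tsum_div_const]
      refine tsum_congr fun n => ?_
      rw [LSeries.term_def]
      split_ifs with hn
      · simp [hn]
      · have : (n : ℂ) ≠ 0 := by exact_mod_cast hn
        rw [Complex.cpow_def_of_ne_zero this, Complex.natCast_log, neg_mul, Complex.exp_neg]
        ring
  · intro n u _
    rw [norm_mul, Complex.norm_real, Complex.norm_real,
      Real.norm_of_nonneg ArithmeticFunction.vonMangoldt_nonneg,
      Real.norm_of_nonneg (le_max_right _ _)]
    exact vonMangoldt_mul_max_le n u

theorem one_div_sub_ne {a s : ℂ} (hs : s.re = 2) (ha : a.re ≤ 3 / 2) : s - a ≠ 0 := fun h => by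
  have : (s - a).re = 0 := by rw [h]; simp
  rw [Complex.sub_re] at this
  linarith

theorem hasLaplace_exp_sub {a : ℂ} (ha : a.re ≤ 3 / 2) (ha0 : a ≠ 0) :
    HasLaplace (fun u => (Complex.exp (a * u) - 1 - a * u) / a ^ 2)
      (fun s => 1 / (s - a) / s ^ 2) := by
  have h := (((hasLaplace_exp ha).sub (hasLaplace_exp (a := 0) (by norm_num))).sub
    (hasLaplace_id.const_mul a)).const_mul (1 / a ^ 2)
  refine h.congr (fun u _ => ?_) fun s hs => ?_
  · simp; ring
  · have h1 := one_div_sub_ne hs ha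
    have h2 : s ≠ 0 := by simpa using one_div_sub_ne (a := 0) hs (by norm_num)
    rw [sub_zero]
    field_simp
    ring

theorem hasLaplace_digamma_term (k : ℕ) :
    HasLaplace (fun u => (1 - Complex.exp (-(2 * ((k : ℂ) + 1)) * u)) / (4 * ((k : ℂ) + 1) ^ 2))
      (fun s => (1 / ((k : ℂ) + 1) - 1 / ((k : ℂ) + 1 + s / 2)) / 2 / s ^ 2) := by
  have hre : (-(2 * ((k : ℂ) + 1))).re ≤ 3 / 2 := by
    simp
    have : (0 : ℝ) ≤ k := k.cast_nonneg
    linarith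
  have h := ((hasLaplace_exp (a := 0) (by norm_num)).sub (hasLaplace_exp hre)).const_mul
    (1 / (4 * ((k : ℂ) + 1) ^ 2))
  refine h.congr (fun u _ => ?_) fun s hs => ?_
  · rw [zero_mul, Complex.exp_zero, one_div_mul_eq_div]
  · have h1 := one_div_sub_ne hs hre
    have h2 : s ≠ 0 := by simpa using one_div_sub_ne (a := 0) hs (by norm_num)
    have h3 : (k : ℂ) + 1 ≠ 0 := by exact_mod_cast k.succ_ne_zero
    have h4 : s + 2 * ((k : ℂ) + 1) ≠ 0 := by rwa [sub_neg_eq_add] at h1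
    have h5 : (k : ℂ) + 1 + s / 2 = (s + 2 * ((k : ℂ) + 1)) / 2 := by ring
    rw [sub_zero, h5, sub_neg_eq_add]
    clear h1 h5 h hre
    generalize (k : ℂ) + 1 = m at *
    obtain ⟨t, ht⟩ : ∃ t, t = s + 2 * m := ⟨_, rfl⟩
    rw [← ht] at h4 ⊢
    field_simp
    rw [ht]
    ring

theorem norm_digamma_laplace_le (k : ℕ) {u : ℝ} (hu : 0 < u) :
    ‖(1 - Complex.exp (-(2 * ((k : ℂ) + 1)) * u)) / (4 * ((k : ℂ) + 1) ^ 2)‖ ≤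
      1 / ((k : ℝ) + 1) ^ 2 * Real.exp (3 / 2 * u) := by
  have e : (1 - Complex.exp (-(2 * ((k : ℂ) + 1)) * u)) / (4 * ((k : ℂ) + 1) ^ 2) =
      (((1 - Real.exp (-(2 * ((k : ℝ) + 1)) * u)) / (4 * ((k : ℝ) + 1) ^ 2) : ℝ) : ℂ) := by
    push_cast; rfl
  have h1 : Real.exp (-(2 * ((k : ℝ) + 1)) * u) ≤ 1 := by
    rw [Real.exp_le_one_iff, neg_mul]
    have : 0 ≤ 2 * ((k : ℝ) + 1) * u := by positivity
    linarith
  have h2 := Real.exp_pos (-(2 * ((k : ℝ) + 1)) * u)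
  have h3 : 1 ≤ Real.exp (3 / 2 * u) := Real.one_le_exp (by positivity)
  rw [e, Complex.norm_real, Real.norm_of_nonneg (by apply div_nonneg; linarith; positivity)]
  calc (1 - Real.exp (-(2 * ((k : ℝ) + 1)) * u)) / (4 * ((k : ℝ) + 1) ^ 2)
      ≤ 1 / (4 * ((k : ℝ) + 1) ^ 2) := by gcongr; linarith
    _ ≤ 1 / ((k : ℝ) + 1) ^ 2 * 1 := by
        rw [mul_one]
        gcongr
        nlinarith [sq_nonneg ((k : ℝ) + 1)]
    _ ≤ _ := by gcongr

/-- The nontrivial zero of zeta with ordinate `γ` under the Riemann hypothesis. -/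
noncomputable def zetaZero (γ : ℝ) : ℂ := 1 / 2 + γ * Complex.I

theorem zetaZero_ne_zero (γ : ℝ) : zetaZero γ ≠ 0 := fun h => by
  have : (zetaZero γ).re = 0 := by rw [h]; simp
  simp [zetaZero] at this

theorem normSq_zetaZero (γ : ℝ) : ‖zetaZero γ‖ ^ 2 = 1 / 4 + γ ^ 2 := by
  rw [← Complex.normSq_eq_norm_sq, Complex.normSq_apply]
  simp [zetaZero]
  ring

theorem zetaZero_mul_neg (γ : ℝ) : zetaZero γ * zetaZero (-γ) = 1 / 4 + (γ : ℂ) ^ 2 := by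
  simp only [zetaZero]
  push_cast
  linear_combination (-(γ : ℂ) ^ 2) * Complex.I_sq

theorem zetaZero_re (γ : ℝ) : (zetaZero γ).re = 1 / 2 := by simp [zetaZero]

/-- The contribution to `psiIntegral` of the pair of zeros with ordinates `±γ`. -/
noncomputable def zeroTerm (γ : ℝ) (u : ℝ) : ℂ :=
  ((Complex.exp (zetaZero γ * u) - 1) / zetaZero γ ^ 2 +
    (Complex.exp (zetaZero (-γ) * u) - 1) / zetaZero (-γ) ^ 2) / 2 - u / (2 * (1 / 4 + γ ^ 2))

theorem hasLaplace_zeroTerm (γ : ℝ) :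
    HasLaplace (zeroTerm γ)
      (fun s => (s - 1 / 2) / ((s - 1 / 2) ^ 2 + (γ : ℂ) ^ 2) / s ^ 2) := by
  have h := ((hasLaplace_exp_sub (a := zetaZero γ) (by rw [zetaZero_re]; norm_num)
    (zetaZero_ne_zero γ)).add (hasLaplace_exp_sub (a := zetaZero (-γ))
      (by rw [zetaZero_re]; norm_num) (zetaZero_ne_zero _))).const_mul (1 / 2)
  refine h.congr (fun u _ => ?_) fun s hs => ?_
  · have h1 := zetaZero_ne_zero γ
    have h2 := zetaZero_ne_zero (-γ)
    have h4 : zetaZero γ + zetaZero (-γ) = 1 := by simp only [zetaZero]; push_cast; ring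
    rw [zeroTerm, ← zetaZero_mul_neg]
    field_simp
    linear_combination (u : ℂ) * zetaZero γ * zetaZero (-γ) * h4
  · have h1 := one_div_sub_ne hs (a := zetaZero γ) (by rw [zetaZero_re]; norm_num)
    have h2 := one_div_sub_ne hs (a := zetaZero (-γ)) (by rw [zetaZero_re]; norm_num)
    have h3 : s ≠ 0 := by simpa using one_div_sub_ne (a := 0) hs (by norm_num)
    have e : (s - 1 / 2) ^ 2 + (γ : ℂ) ^ 2 = (s - zetaZero γ) * (s - zetaZero (-γ)) := by
      simp only [zetaZero]
      push_cast
      linear_combination (γ : ℂ) ^ 2 * Complex.I_sq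
    have h4 : zetaZero γ + zetaZero (-γ) = 1 := by simp only [zetaZero]; push_cast; ring
    rw [e]
    field_simp
    linear_combination (1 : ℂ) * h4

theorem norm_exp_zetaZero (γ u : ℝ) : ‖Complex.exp (zetaZero γ * u)‖ = Real.exp (u / 2) := by
  rw [Complex.norm_exp]
  simp [zetaZero]
  ring

theorem norm_zeroTerm_le (γ : ℝ) {u : ℝ} (hu : 0 < u) :
    ‖zeroTerm γ u‖ ≤ 2 / (1 / 4 + γ ^ 2) * Real.exp (3 / 2 * u) := by
  have h1 : ∀ γ : ℝ, ‖(Complex.exp (zetaZero γ * u) - 1) / zetaZero γ ^ 2‖ ≤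
      (Real.exp (u / 2) + 1) / (1 / 4 + γ ^ 2) := by
    intro γ
    rw [norm_div, norm_pow, normSq_zetaZero, ← norm_exp_zetaZero γ u]
    gcongr
    exact (norm_sub_le _ _).trans (by simp)
  have h2 := h1 γ
  have h3 := h1 (-γ)
  rw [neg_sq] at h3
  have h4 : ‖(u : ℂ) / (2 * (1 / 4 + γ ^ 2))‖ = u / 2 / (1 / 4 + γ ^ 2) := by
    have : (u : ℂ) / (2 * (1 / 4 + γ ^ 2)) = ((u / (2 * (1 / 4 + γ ^ 2)) : ℝ) : ℂ) := by
      push_cast; rfl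
    rw [this, Complex.norm_real, Real.norm_of_nonneg (by positivity)]
    field_simp
  have h5 : ‖zeroTerm γ u‖ ≤ (Real.exp (u / 2) + 1 + u / 2) / (1 / 4 + γ ^ 2) := by
    rw [zeroTerm]
    refine (norm_sub_le _ _).trans ?_
    rw [h4, norm_div, add_div _ (u / 2)]
    refine add_le_add_left ?_ _
    have := norm_add_le ((Complex.exp (zetaZero γ * u) - 1) / zetaZero γ ^ 2)
      ((Complex.exp (zetaZero (-γ) * u) - 1) / zetaZero (-γ) ^ 2)
    have h6 : ‖(2 : ℂ)‖ = 2 := by simp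
    refine (div_le_div_of_nonneg_right this (norm_nonneg _)).trans ?_
    rw [h6]
    linarith
  refine h5.trans ?_
  rw [div_mul_eq_mul_div]
  gcongr
  have e1 := Real.add_one_le_exp (3 / 2 * u)
  have e2 : Real.exp (u / 2) ≤ Real.exp (3 / 2 * u) := Real.exp_le_exp.2 (by linarith)
  linarith

instance : Countable XiZero := by
  have hw : centredXi (1 / 2) ≠ 0 := by norm_num [centredXi]
  have h : (⋃ n : ℕ, {a | ‖a‖ ≤ (n : ℝ) ∧ centredXi a = 0}).Countable :=
    countable_iUnion fun n => (finite_zeros_closedBall differentiable_centredXi hw n).countable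
  have : Countable ↥(⋃ n : ℕ, {a | ‖a‖ ≤ (n : ℝ) ∧ centredXi a = 0}) := h.to_subtype
  refine Function.Injective.countable (f := fun γ : XiZero =>
    (⟨Complex.I * (γ : ℝ), mem_iUnion.2 ?_⟩ :
      ↥(⋃ n : ℕ, {a | ‖a‖ ≤ (n : ℝ) ∧ centredXi a = 0}))) fun x y hxy => ?_
  · obtain ⟨n, hn⟩ := exists_nat_ge ‖Complex.I * (γ : ℝ)‖
    exact ⟨n, hn, γ.2⟩
  · simpa [Subtype.ext_iff] using hxy

theorem summable_xiMult (hRH : RiemannHypothesis) :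
    Summable fun γ : XiZero => (xiMult γ : ℝ) * (2 / (1 / 4 + (γ : ℝ) ^ 2)) := by
  refine ((hasSum_xiZero_real hRH (b := 1 / 2) (by norm_num)).summable.mul_left 4).congr
    fun γ => ?_
  ring

theorem psiIntegral_eq (hRH : RiemannHypothesis) {u : ℝ} (hu : 0 < u) :
    (psiIntegral u : ℂ) = Complex.exp u - 1 - u +
      (Complex.digamma 1 / 2 - Real.log Real.pi / 2) * u +
      ∑' k : ℕ, (1 - Complex.exp (-(2 * ((k : ℂ) + 1)) * u)) / (4 * ((k : ℂ) + 1) ^ 2) -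
      ∑' γ : XiZero, (xiMult γ : ℂ) * zeroTerm γ u := by
  have hA := hasLaplace_exp_sub (a := 1) (by norm_num) one_ne_zero
  have hB := hasLaplace_id.const_mul (Complex.digamma 1 / 2 - Real.log Real.pi / 2)
  have hC := HasLaplace.tsum hasLaplace_digamma_term summable_one_div_add_one_sq
    fun k u hu => norm_digamma_laplace_le k hu
  have hD := HasLaplace.tsum (fun γ : XiZero => (hasLaplace_zeroTerm γ).const_mul (xiMult γ : ℂ))
    (summable_xiMult hRH) fun γ u hu => by
      rw [norm_mul, Complex.norm_natCast, mul_assoc]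
      exact mul_le_mul_of_nonneg_left (norm_zeroTerm_le γ hu) (Nat.cast_nonneg _)
  have hE : HasLaplace (fun u : ℝ => Complex.exp u - 1 - u +
      (Complex.digamma 1 / 2 - Real.log Real.pi / 2) * u +
      ∑' k : ℕ, (1 - Complex.exp (-(2 * ((k : ℂ) + 1)) * u)) / (4 * ((k : ℂ) + 1) ^ 2) -
      ∑' γ : XiZero, (xiMult γ : ℂ) * zeroTerm γ u)
      (fun s => (-deriv riemannZeta s / riemannZeta s) / s ^ 2) := by
    refine (((hA.add hB).add hC).sub hD).congr (fun u _ => by simp) fun s hs => ?_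
    rw [neg_logDeriv_zeta_eq (by rw [hs]; norm_num), tsum_div_const,
      ← (hasSum_xiZero hRH (z := s - 1 / 2) (by simp [hs]; norm_num)).tsum_eq]
    simp only [← mul_div_assoc, tsum_div_const]
    ring
  exact hasLaplace_psiIntegral.unique hE hu

end

section

open Filter Topology Metric Set MeasureTheory
open ArithmeticFunction (vonMangoldt vonMangoldt_nonneg)

theorem mul_psi_le {u w : ℝ} (hw : 0 ≤ w) :
    w * Chebyshev.psi (Real.exp u) ≤ psiIntegral (u + w) - psiIntegral u := by
  have hs := (summable_psiIntegral (u + w)).sub (summable_psiIntegral u)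
  rw [psiIntegral, psiIntegral, ← (summable_psiIntegral (u + w)).tsum_sub (summable_psiIntegral u),
    Chebyshev.psi, Finset.mul_sum]
  refine le_trans (Finset.sum_le_sum fun n hn => ?_) (hs.sum_le_tsum _ fun n _ => ?_)
  · rw [← mul_sub, mul_comm w]
    refine mul_le_mul_of_nonneg_left ?_ vonMangoldt_nonneg
    rw [Finset.mem_Ioc] at hn
    have h1 : (n : ℝ) ≤ Real.exp u := (Nat.le_floor_iff (Real.exp_pos u).le).1 hn.2
    have h2 : Real.log n ≤ u := by
      rw [Real.log_le_iff_le_exp (by exact_mod_cast hn.1)]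
      exact h1
    rw [max_eq_left (by linarith), max_eq_left (by linarith)]
    linarith
  · rw [← mul_sub]
    refine mul_nonneg vonMangoldt_nonneg (sub_nonneg.2 ?_)
    gcongr
    linarith

theorem le_mul_psi {u w : ℝ} (hw : 0 ≤ w) :
    psiIntegral u - psiIntegral (u - w) ≤ w * Chebyshev.psi (Real.exp u) := by
  rw [psiIntegral, psiIntegral, ← (summable_psiIntegral u).tsum_sub (summable_psiIntegral (u - w)),
    Chebyshev.psi, Finset.mul_sum]
  rw [tsum_eq_sum (s := Finset.Ioc 0 ⌊Real.exp u⌋₊) fun n hn => ?_]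
  · refine Finset.sum_le_sum fun n hn => ?_
    rw [← mul_sub, mul_comm w]
    refine mul_le_mul_of_nonneg_left ?_ vonMangoldt_nonneg
    rcases le_total (u - Real.log n) 0 with h | h
    · rw [max_eq_right h]
      linarith [le_max_right (u - w - Real.log n) 0]
    · rw [max_eq_left h]
      linarith [le_max_left (u - w - Real.log n) 0]
  · rcases Nat.eq_zero_or_pos n with rfl | h0
    · simp
    have h1 : ⌊Real.exp u⌋₊ < n := by
      by_contra! h
      exact hn (Finset.mem_Ioc.2 ⟨h0, h⟩)
    have h2 : u ≤ Real.log n := by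
      rw [Real.le_log_iff_exp_le (by exact_mod_cast h0)]
      exact ((Nat.floor_lt (Real.exp_pos u).le).1 h1).le
    rw [max_eq_right (by linarith), max_eq_right (by linarith)]
    simp

/-- The weight with which a zero of ordinate `γ` enters a smoothed explicit formula. -/
noncomputable def zeroWeight (T γ : ℝ) : ℝ := min (1 / ‖zetaZero γ‖) (T / ‖zetaZero γ‖ ^ 2)

theorem norm_exp_zetaZero_sub_le (γ : ℝ) {v w T : ℝ} (hw : 0 ≤ w) (hT : T * w = 2) :
    ‖(Complex.exp (zetaZero γ * ((v + w : ℝ) : ℂ)) - 1) / zetaZero γ ^ 2 -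
      (Complex.exp (zetaZero γ * v) - 1) / zetaZero γ ^ 2‖ ≤
      w * Real.exp ((v + w) / 2) * zeroWeight T γ := by
  have hr : 0 < ‖zetaZero γ‖ := norm_pos_iff.2 (zetaZero_ne_zero γ)
  have hle : Real.exp (v / 2) ≤ Real.exp ((v + w) / 2) := Real.exp_le_exp.2 (by linarith)
  rw [← sub_div, sub_sub_sub_cancel_right, norm_div, norm_pow, zeroWeight,
    mul_min_of_nonneg _ _ (by positivity)]
  refine le_min ?_ ?_
  · have h1 : ∀ x ∈ Icc v (v + w), HasDerivWithinAt
        (fun x : ℝ => Complex.exp (zetaZero γ * x)) (Complex.exp (zetaZero γ * x) * zetaZero γ)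
        (Icc v (v + w)) x := by
      intro x _
      have h0 : HasDerivAt (fun u : ℝ => (u : ℂ)) 1 x := Complex.ofRealCLM.hasDerivAt
      simpa using ((h0.const_mul (zetaZero γ)).cexp).hasDerivWithinAt
    have h2 : ∀ x ∈ Icc v (v + w), ‖Complex.exp (zetaZero γ * x) * zetaZero γ‖ ≤
        Real.exp ((v + w) / 2) * ‖zetaZero γ‖ := by
      intro x hx
      rw [norm_mul, norm_exp_zetaZero]
      gcongr
      exact hx.2
    have h3 := norm_image_sub_le_of_norm_deriv_le_segment' h1
      (fun x hx => h2 x ⟨hx.1, hx.2.le⟩) (v + w) ⟨by linarith, le_rfl⟩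
    rw [div_le_iff₀ (by positivity)]
    refine h3.trans (le_of_eq ?_)
    field_simp
    ring
  · have h1 : ‖Complex.exp (zetaZero γ * ((v + w : ℝ) : ℂ)) - Complex.exp (zetaZero γ * v)‖ ≤
        2 * Real.exp ((v + w) / 2) := by
      refine (norm_sub_le _ _).trans ?_
      rw [norm_exp_zetaZero, norm_exp_zetaZero]
      linarith
    rw [← mul_div_assoc]
    gcongr
    linear_combination h1 + Real.exp ((v + w) / 2) * hT.symm

theorem zeroWeight_neg (T γ : ℝ) : zeroWeight T (-γ) = zeroWeight T γ := by
  have : ‖zetaZero (-γ)‖ = ‖zetaZero γ‖ := by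
    rw [← sq_eq_sq₀ (norm_nonneg _) (norm_nonneg _), normSq_zetaZero, normSq_zetaZero, neg_sq]
  rw [zeroWeight, this, zeroWeight]

theorem norm_zeroTerm_sub_le (γ : ℝ) {v w T : ℝ} (hw : 0 ≤ w) (hT : T * w = 2) :
    ‖zeroTerm γ (v + w) - zeroTerm γ v‖ ≤
      w * (Real.exp ((v + w) / 2) * zeroWeight T γ + 1 / 2 / (1 / 4 + γ ^ 2)) := by
  have h1 := norm_exp_zetaZero_sub_le γ (v := v) hw hT
  have h2 := norm_exp_zetaZero_sub_le (-γ) (v := v) hw hT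
  rw [zeroWeight_neg] at h2
  have h3 : zeroTerm γ (v + w) - zeroTerm γ v =
      (((Complex.exp (zetaZero γ * ((v + w : ℝ) : ℂ)) - 1) / zetaZero γ ^ 2 -
        (Complex.exp (zetaZero γ * v) - 1) / zetaZero γ ^ 2) +
      ((Complex.exp (zetaZero (-γ) * ((v + w : ℝ) : ℂ)) - 1) / zetaZero (-γ) ^ 2 -
        (Complex.exp (zetaZero (-γ) * v) - 1) / zetaZero (-γ) ^ 2)) * ((1 / 2 : ℝ) : ℂ) -
      ((w * (1 / 2 / (1 / 4 + γ ^ 2)) : ℝ) : ℂ) := by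
    rw [zeroTerm, zeroTerm, div_mul_eq_div_div, div_mul_eq_div_div]
    push_cast
    ring
  rw [h3]
  refine (norm_sub_le _ _).trans ?_
  rw [norm_mul, Complex.norm_real, Complex.norm_real, Real.norm_of_nonneg (by positivity),
    Real.norm_of_nonneg (by positivity)]
  have h4 := (norm_add_le _ _).trans (add_le_add h1 h2)
  linarith

theorem zeroWeight_nonneg {T : ℝ} (hT : 0 ≤ T) (γ : ℝ) : 0 ≤ zeroWeight T γ :=
  le_min (by positivity) (by positivity)

theorem summable_zeroWeight (hRH : RiemannHypothesis) {T : ℝ} (hT : 0 ≤ T) :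
    Summable fun γ : XiZero => (xiMult γ : ℝ) * zeroWeight T γ := by
  refine Summable.of_nonneg_of_le (fun γ => mul_nonneg (Nat.cast_nonneg _)
    (zeroWeight_nonneg hT _)) (fun γ => ?_) ((summable_xiMult hRH).mul_right (T / 2))
  rw [mul_assoc]
  refine mul_le_mul_of_nonneg_left ((min_le_right _ _).trans (le_of_eq ?_)) (Nat.cast_nonneg _)
  rw [normSq_zetaZero]
  ring

theorem digamma_sum_sub {v w : ℝ} (hv : 1 ≤ v) (hw : 0 ≤ w) :
    ∃ δ : ℝ, 0 ≤ δ ∧ δ ≤ w ∧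
      (∑' k : ℕ, (1 - Complex.exp (-(2 * ((k : ℂ) + 1)) * ((v + w : ℝ) : ℂ))) /
        (4 * ((k : ℂ) + 1) ^ 2) -
      ∑' k : ℕ, (1 - Complex.exp (-(2 * ((k : ℂ) + 1)) * (v : ℂ))) / (4 * ((k : ℂ) + 1) ^ 2) : ℂ) =
        (δ : ℂ) := by
  have hv0 : 0 < v := by linarith
  set d : ℝ → ℕ → ℝ := fun u k => (1 - Real.exp (-(2 * ((k : ℝ) + 1)) * u)) /
    (4 * ((k : ℝ) + 1) ^ 2) with hd
  have he : ∀ u : ℝ, ∑' k : ℕ, (1 - Complex.exp (-(2 * ((k : ℂ) + 1)) * u)) /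
      (4 * ((k : ℂ) + 1) ^ 2) = ((∑' k, d u k : ℝ) : ℂ) := by
    intro u
    rw [Complex.ofReal_tsum]
    refine tsum_congr fun k => ?_
    simp only [hd]
    push_cast
    rfl
  have hsum : ∀ u : ℝ, 0 < u → Summable (d u) := by
    intro u hu
    refine Summable.of_norm_bounded (summable_one_div_add_one_sq.mul_right
      (Real.exp (3 / 2 * u))) fun k => ?_
    refine le_trans (le_of_eq ?_) (norm_digamma_laplace_le k hu)
    rw [← Complex.norm_real]
    simp only [hd]
    push_cast
    rfl
  have h0 : ∀ k, 0 ≤ d (v + w) k - d v k ∧ d (v + w) k - d v k ≤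
      w / 4 * (1 / ((k : ℝ) + 1) ^ 2) := by
    intro k
    have hm : (0 : ℝ) < (k : ℝ) + 1 := by positivity
    have hdk : ∀ u, d u k = (1 - Real.exp (-(2 * ((k : ℝ) + 1)) * u)) / (4 * ((k : ℝ) + 1) ^ 2) :=
      fun _ => rfl
    generalize (k : ℝ) + 1 = m at *
    have e : d (v + w) k - d v k = Real.exp (-(2 * m) * v) * (1 - Real.exp (-(2 * m) * w)) /
        (4 * m ^ 2) := by
      rw [hdk, hdk, mul_add, Real.exp_add]
      ring
    rw [e]
    have h1 : Real.exp (-(2 * m) * w) ≤ 1 := by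
      rw [Real.exp_le_one_iff, neg_mul]
      have : 0 ≤ 2 * m * w := by positivity
      linarith
    have h2 : 1 - Real.exp (-(2 * m) * w) ≤ 2 * m * w := by
      have := Real.add_one_le_exp (-(2 * m) * w)
      linarith
    have h3 : Real.exp (-(2 * m) * v) ≤ 1 / (2 * m) := by
      rw [neg_mul, Real.exp_neg, ← one_div]
      have := Real.add_one_le_exp (2 * m * v)
      gcongr
      nlinarith
    refine ⟨by apply div_nonneg _ (by positivity); apply mul_nonneg (Real.exp_pos _).le; linarith, ?_⟩
    calc Real.exp (-(2 * m) * v) * (1 - Real.exp (-(2 * m) * w)) / (4 * m ^ 2)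
        ≤ 1 / (2 * m) * (2 * m * w) / (4 * m ^ 2) := by
          gcongr
      _ = w / 4 * (1 / m ^ 2) := by field_simp
  refine ⟨∑' k, (d (v + w) k - d v k), tsum_nonneg fun k => (h0 k).1, ?_, ?_⟩
  · have hz := hasSum_zeta_two
    rw [← hasSum_nat_add_iff' 1] at hz
    simp only [Finset.sum_range_one, Nat.cast_zero, ne_eq, OfNat.ofNat_ne_zero, not_false_eq_true,
      zero_pow, div_zero, sub_zero, Nat.cast_add, Nat.cast_one] at hz
    refine (((hsum (v + w) (by linarith)).sub (hsum v hv0)).tsum_le_tsum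
      (fun k => (h0 k).2) (hz.summable.mul_left _)).trans ?_
    rw [tsum_mul_left, hz.tsum_eq]
    have := Real.pi_le_four
    have := Real.pi_pos
    have : Real.pi ^ 2 / 6 ≤ 4 := by nlinarith
    nlinarith
  · rw [he, he, (hsum (v + w) (by linarith)).tsum_sub (hsum v hv0)]
    push_cast
    rfl

theorem psiIntegral_sub_bounds (hRH : RiemannHypothesis) {v w T : ℝ} (hv : 1 ≤ v) (hw : 0 < w)
    (hT : T * w = 2) :
    let S := w * (Real.exp ((v + w) / 2) * ∑' γ : XiZero, (xiMult γ : ℝ) * zeroWeight T γ +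
      ∑' γ : XiZero, (xiMult γ : ℝ) * (1 / 2 / (1 / 4 + (γ : ℝ) ^ 2)))
    psiIntegral (v + w) - psiIntegral v ≤ Real.exp (v + w) - Real.exp v + S ∧
    Real.exp (v + w) - Real.exp v - 3 * w - S ≤ psiIntegral (v + w) - psiIntegral v := by
  intro S
  have hT0 : 0 ≤ T := by
    by_contra! h
    nlinarith
  obtain ⟨δ, hδ0, hδ, hδe⟩ := digamma_sum_sub hv hw.le
  have hsz : ∀ u : ℝ, 0 < u → Summable fun γ : XiZero => (xiMult γ : ℂ) * zeroTerm γ u := by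
    intro u hu
    refine Summable.of_norm_bounded ((summable_xiMult hRH).mul_right (Real.exp (3 / 2 * u)))
      fun γ => ?_
    rw [norm_mul, Complex.norm_natCast, mul_assoc]
    exact mul_le_mul_of_nonneg_left (norm_zeroTerm_le γ hu) (Nat.cast_nonneg _)
  set R : ℂ := ∑' γ : XiZero, (xiMult γ : ℂ) * zeroTerm γ (v + w) -
    ∑' γ : XiZero, (xiMult γ : ℂ) * zeroTerm γ v with hR
  have hRle : ‖R‖ ≤ S := by
    have hs1 := summable_zeroWeight hRH hT0
    have hs2 : Summable fun γ : XiZero => (xiMult γ : ℝ) * (1 / 2 / (1 / 4 + (γ : ℝ) ^ 2)) :=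
      ((summable_xiMult hRH).mul_left (1 / 4)).congr fun γ => by ring
    rw [hR, ← (hsz (v + w) (by linarith)).tsum_sub (hsz v (by linarith))]
    refine tsum_of_norm_bounded (((hs1.hasSum.mul_left (Real.exp ((v + w) / 2))).add
      hs2.hasSum).mul_left w) fun γ => ?_
    rw [← mul_sub, norm_mul, Complex.norm_natCast]
    refine (mul_le_mul_of_nonneg_left (norm_zeroTerm_sub_le γ hw.le hT)
      (Nat.cast_nonneg _)).trans (le_of_eq ?_)
    ring
  have key : ((psiIntegral (v + w) - psiIntegral v : ℝ) : ℂ) =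
      ((Real.exp (v + w) - Real.exp v - w -
        (Real.eulerMascheroniConstant / 2 + Real.log Real.pi / 2) * w + δ : ℝ) : ℂ) - R := by
    rw [Complex.ofReal_sub, psiIntegral_eq hRH (u := v + w) (by linarith),
      psiIntegral_eq hRH (u := v) (by linarith), Complex.digamma_one, hR]
    push_cast
    push_cast at hδe
    linear_combination hδe
  have hre := congrArg Complex.re key
  rw [Complex.sub_re, Complex.ofReal_re, Complex.ofReal_re] at hre
  have h1 := (abs_le.1 ((Complex.abs_re_le_norm R).trans hRle))
  have hg1 := Real.eulerMascheroniConstant_lt_two_thirds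
  have hg0 := Real.one_half_lt_eulerMascheroniConstant
  have hl0 : 0 ≤ Real.log Real.pi := Real.log_nonneg (by linarith [Real.pi_gt_three])
  have hl1 : Real.log Real.pi ≤ 3 := by
    have := Real.log_le_sub_one_of_pos Real.pi_pos
    linarith [Real.pi_le_four]
  constructor
  · nlinarith
  · nlinarith

end

section

open Filter Topology Metric Set MeasureTheory

theorem one_le_arctan_add {s : ℝ} (hs : 0 < s) :
    min 1 s ≤ 2 / Real.pi * Real.arctan s + s / (1 + s ^ 2) := by
  have hpi := Real.pi_pos
  set θ := Real.arctan s with hθ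
  have hθ0 : 0 < θ := Real.arctan_pos.2 hs
  have hθ1 : θ < Real.pi / 2 := Real.arctan_lt_pi_div_two s
  have hc : 0 < Real.cos θ := Real.cos_arctan_pos s
  have htan : Real.sin θ = s * Real.cos θ := by
    rw [← Real.tan_arctan s, ← hθ, Real.tan_mul_cos hc.ne']
  have hc2 : Real.cos θ ^ 2 = 1 / (1 + s ^ 2) := Real.cos_sq_arctan s
  have hfrac : s / (1 + s ^ 2) = Real.sin θ * Real.cos θ := by
    rw [htan, mul_assoc, ← sq, hc2]
    ring
  rw [hfrac]
  rcases le_total s 1 with h | h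
  · rw [min_eq_right h]
    have h1 : θ ≤ Real.pi / 4 := by
      rw [hθ, ← Real.arctan_one]
      exact Real.arctan_strictMono.monotone h
    have h2 := Real.one_sub_mul_le_cos (x := 2 * θ) (by linarith) (by linarith)
    rw [Real.cos_two_mul] at h2
    have h4 : s - Real.sin θ * Real.cos θ = s * (1 - Real.cos θ ^ 2) := by rw [htan]; ring
    have h5 : s * (1 - Real.cos θ ^ 2) ≤ 1 * (1 - Real.cos θ ^ 2) := by
      have := Real.cos_sq_le_one θ
      gcongr
    linarith
  · rw [min_eq_left h]
    have h1 : Real.pi / 4 ≤ θ := by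
      rw [hθ, ← Real.arctan_one]
      exact Real.arctan_strictMono.monotone h
    have h2 := Real.mul_le_sin (x := Real.pi - 2 * θ) (by linarith) (by linarith)
    rw [Real.sin_pi_sub, Real.sin_two_mul] at h2
    have h3 : 2 / Real.pi * (Real.pi - 2 * θ) = 2 - 2 * (2 / Real.pi * θ) := by field_simp
    linarith

theorem integral_one_div_sq_add_sq {t : ℝ} (ht : 0 < t) (a b : ℝ) :
    ∫ x in a..b, 1 / (x ^ 2 + t ^ 2) = (Real.arctan (b / t) - Real.arctan (a / t)) / t := by
  rw [sub_div]
  refine intervalIntegral.integral_eq_sub_of_hasDerivAt (f := fun x => Real.arctan (x / t) / t)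
    (fun x _ => ?_) ?_
  · have := ((hasDerivAt_id x).div_const t).arctan.div_const t
    refine this.congr_deriv ?_
    simp only [id]
    field_simp
    ring
  · refine Continuous.intervalIntegrable ?_ _ _
    refine continuous_const.div (by fun_prop) fun x => ?_
    positivity

theorem zeroWeight_le {T : ℝ} (hT : 2 ≤ T) (γ : ℝ) :
    zeroWeight T γ ≤ 2 / Real.pi * (∫ b in (2 : ℝ)..T, 1 / (b ^ 2 + γ ^ 2)) + T / (T ^ 2 + γ ^ 2) +
      8 / (4 + γ ^ 2) := by
  have hr : 0 < ‖zetaZero γ‖ := norm_pos_iff.2 (zetaZero_ne_zero γ)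
  have hr2 := normSq_zetaZero γ
  have hpi := Real.pi_pos
  have hI : 0 ≤ ∫ b in (2 : ℝ)..T, 1 / (b ^ 2 + γ ^ 2) :=
    intervalIntegral.integral_nonneg hT fun _ _ => by positivity
  rcases le_total (γ ^ 2) 4 with h | h
  · have h1 : 1 / ‖zetaZero γ‖ ≤ 8 / (4 + γ ^ 2) := by
      rw [div_le_div_iff₀ hr (by positivity), one_mul]
      rw [← sq_le_sq₀ (by positivity) (by positivity), mul_pow, hr2]
      nlinarith [sq_nonneg γ]
    have h2 : 0 ≤ T / (T ^ 2 + γ ^ 2) := by positivity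
    have h3 : 0 ≤ 2 / Real.pi * ∫ b in (2 : ℝ)..T, 1 / (b ^ 2 + γ ^ 2) := by positivity
    exact (min_le_left _ _).trans (by linarith)
  · set t := |γ| with ht
    have htsq : t ^ 2 = γ ^ 2 := sq_abs γ
    rw [← htsq] at h hI hr2 ⊢
    have ht2 : 2 ≤ t := by
      have := abs_nonneg γ
      nlinarith
    have ht0 : 0 < t := by linarith
    have hT0 : 0 < T := by linarith
    have hrt : t ≤ ‖zetaZero γ‖ := by
      rw [← sq_le_sq₀ ht0.le hr.le, hr2]
      linarith
    have hK : zeroWeight T γ ≤ min 1 (T / t) / t := by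
      rw [zeroWeight, le_div_iff₀ ht0, min_mul_of_nonneg _ _ ht0.le]
      refine min_le_min ?_ ?_
      · rw [one_div_mul_eq_div, div_le_one hr]
        exact hrt
      · rw [div_mul_eq_mul_div, div_le_div_iff₀ (by positivity) ht0]
        nlinarith
    rw [integral_one_div_sq_add_sq ht0]
    have h1 := one_le_arctan_add (s := T / t) (by positivity)
    have h2 : Real.arctan (2 / t) ≤ 2 / t := by
      have h5 := Real.le_tan (Real.arctan_nonneg.2 (by positivity : 0 ≤ 2 / t))
        (Real.arctan_lt_pi_div_two _)
      rwa [Real.tan_arctan] at h5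
    have h3 : 2 / Real.pi * (Real.arctan (2 / t) / t) ≤ 8 / (4 + t ^ 2) := by
      calc 2 / Real.pi * (Real.arctan (2 / t) / t) ≤ 1 * (2 / t / t) := by
            gcongr
            rw [div_le_one hpi]
            linarith [Real.pi_gt_three]
        _ ≤ 8 / (4 + t ^ 2) := by
            rw [one_mul, div_div, div_le_div_iff₀ (by positivity) (by positivity)]
            nlinarith
    have h4 : T / t / (1 + (T / t) ^ 2) / t = T / (T ^ 2 + t ^ 2) := by
      field_simp
      ring
    calc zeroWeight T γ ≤ min 1 (T / t) / t := hK
      _ ≤ (2 / Real.pi * Real.arctan (T / t) + T / t / (1 + (T / t) ^ 2)) / t := by gcongr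
      _ = 2 / Real.pi * ((Real.arctan (T / t) - Real.arctan (2 / t)) / t) + T / (T ^ 2 + t ^ 2) +
          2 / Real.pi * (Real.arctan (2 / t) / t) := by rw [← h4]; ring
      _ ≤ _ := by gcongr

theorem logDeriv_centredXi_re_le_log {b : ℝ} (hb : 2 ≤ b) :
    (logDeriv centredXi b).re ≤ Real.log (b / (2 * Real.pi)) / 2 + 12 / 5 / b := by
  have hpi := Real.pi_pos
  refine (logDeriv_centredXi_re_le (by linarith)).trans ?_
  have h1 : Real.log ((b + 1 / 2) / (2 * Real.pi)) ≤
      Real.log (b / (2 * Real.pi)) + 1 / 2 / b := by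
    have e : (b + 1 / 2) / (2 * Real.pi) = b / (2 * Real.pi) * (1 + 1 / 2 / b) := by
      field_simp
    rw [e, Real.log_mul (by positivity) (by positivity)]
    have := Real.log_le_sub_one_of_pos (x := 1 + 1 / 2 / b) (by positivity)
    linarith
  have h2 : 1 / (b + 1 / 2) + 1 / (b - 1 / 2) ≤ 32 / 15 / b := by
    have : 0 < b - 1 / 2 := by linarith
    rw [div_add_div _ _ (by positivity) (by positivity), div_le_div_iff₀ (by positivity) (by positivity)]
    nlinarith
  have h3 : 12 / 5 / b = 1 / 2 / b / 2 + 32 / 15 / b + 1 / 60 / b := by ring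
  have h4 : 0 ≤ 1 / 60 / b := by positivity
  linarith

theorem logDeriv_centredXi_two_re_le : (logDeriv centredXi (2 : ℝ)).re ≤ 37 / 60 := by
  refine (logDeriv_centredXi_re_le (by norm_num)).trans ?_
  have h1 : Real.exp (9 / 10) < 2.46 := by
    refine lt_of_pow_lt_pow_left₀ 10 (by norm_num) ?_
    rw [← Real.exp_nat_mul, show ((10 : ℕ) : ℝ) * (9 / 10) = (9 : ℕ) * 1 by norm_num,
      Real.exp_nat_mul]
    refine lt_trans (pow_lt_pow_left₀ Real.exp_one_lt_d9 (Real.exp_pos _).le (by norm_num)) ?_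
    norm_num
  have h2 : Real.log ((2 + 1 / 2) / (2 * Real.pi)) ≤ -(9 / 10) := by
    rw [Real.log_le_iff_le_exp (by positivity), Real.exp_neg, ← one_div,
      div_le_div_iff₀ (by positivity) (Real.exp_pos _)]
    linarith [Real.pi_gt_d2]
  norm_num at h2 ⊢
  linarith

theorem sum_xiMult_le (hRH : RiemannHypothesis) {b : ℝ} (hb : 0 < b) (s : Finset XiZero) :
    ∑ γ ∈ s, (xiMult γ : ℝ) * (b / (b ^ 2 + (γ : ℝ) ^ 2)) ≤ (logDeriv centredXi b).re := by
  have h := hasSum_xiZero_real hRH hb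
  rw [← h.tsum_eq]
  exact h.summable.sum_le_tsum s fun γ _ => by positivity

theorem integral_log_majorant {T : ℝ} (hT : 2 ≤ T) :
    IntervalIntegrable (fun b => (Real.log (b / (2 * Real.pi)) / 2 + 12 / 5 / b) / b) volume 2 T ∧
    ∫ b in (2 : ℝ)..T, (Real.log (b / (2 * Real.pi)) / 2 + 12 / 5 / b) / b =
      Real.log (T / (2 * Real.pi)) ^ 2 / 4 - 12 / 5 / T - (Real.log Real.pi ^ 2 / 4 - 6 / 5) := by
  have hpi := Real.pi_pos
  have hpos : ∀ b ∈ uIcc 2 T, (0 : ℝ) < b := by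
    intro b hb
    rw [uIcc_of_le hT] at hb
    linarith [hb.1]
  have hint : IntervalIntegrable (fun b => (Real.log (b / (2 * Real.pi)) / 2 + 12 / 5 / b) / b)
      volume 2 T := by
    refine ContinuousOn.intervalIntegrable fun b hb => ?_
    have hb0 := (hpos b hb).ne'
    have : b / (2 * Real.pi) ≠ 0 := by positivity
    apply ContinuousAt.continuousWithinAt
    fun_prop (disch := assumption)
  refine ⟨hint, ?_⟩
  rw [intervalIntegral.integral_eq_sub_of_hasDerivAt
    (f := fun b => Real.log (b / (2 * Real.pi)) ^ 2 / 4 - 12 / 5 * b⁻¹) (fun b hb => ?_) hint]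
  · have : Real.log (2 / (2 * Real.pi)) = -Real.log Real.pi := by
      rw [← Real.log_inv]
      congr 1
      field_simp
    rw [this]
    ring
  · have hb0 := (hpos b hb).ne'
    have hne : b / (2 * Real.pi) ≠ 0 := by positivity
    have h1 := ((((hasDerivAt_id b).div_const (2 * Real.pi)).log hne).pow 2).div_const 4
    have h2 := h1.sub ((hasDerivAt_inv hb0).const_mul (12 / 5))
    refine h2.congr_deriv ?_
    simp only [id]
    field_simp
    ring

theorem sum_zeroWeight_le (hRH : RiemannHypothesis) {T : ℝ} (hT : 1000 ≤ T) :
    ∑' γ : XiZero, (xiMult γ : ℝ) * zeroWeight T γ ≤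
      Real.log (T / (2 * Real.pi)) ^ 2 / (2 * Real.pi) + Real.log (T / (2 * Real.pi)) / 2 +
        3.08 := by
  have hpi := Real.pi_pos
  have hT2 : 2 ≤ T := by linarith
  refine (summable_zeroWeight hRH (by linarith)).tsum_le_of_sum_le fun s => ?_
  obtain ⟨hint, hval⟩ := integral_log_majorant hT2
  have hci : ∀ γ : XiZero, IntervalIntegrable
      (fun b => (xiMult γ : ℝ) * (1 / (b ^ 2 + (γ : ℝ) ^ 2))) volume 2 T := by
    intro γ
    refine ContinuousOn.intervalIntegrable fun b hb => ?_
    rw [uIcc_of_le hT2] at hb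
    have : b ^ 2 + (γ : ℝ) ^ 2 ≠ 0 := by
      have := hb.1
      positivity
    apply ContinuousAt.continuousWithinAt
    fun_prop (disch := assumption)
  have h1 : ∑ γ ∈ s, (xiMult γ : ℝ) * (∫ b in (2 : ℝ)..T, 1 / (b ^ 2 + (γ : ℝ) ^ 2)) ≤
      Real.log (T / (2 * Real.pi)) ^ 2 / 4 - 12 / 5 / T - (Real.log Real.pi ^ 2 / 4 - 6 / 5) := by
    rw [← hval]
    simp_rw [← intervalIntegral.integral_const_mul]
    rw [← intervalIntegral.integral_finsetSum fun γ _ => hci γ]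
    refine intervalIntegral.integral_mono_on hT2
      (by simpa only [Finset.sum_fn] using IntervalIntegrable.sum s fun γ _ => hci γ) hint
      fun b hb => ?_
    have hb0 : 0 < b := by linarith [hb.1]
    rw [le_div_iff₀ hb0, Finset.sum_mul]
    refine le_trans (le_of_eq (Finset.sum_congr rfl fun γ _ => ?_))
      ((sum_xiMult_le hRH hb0 s).trans (logDeriv_centredXi_re_le_log hb.1))
    ring
  have h2 := (sum_xiMult_le hRH (by linarith : 0 < T) s).trans (logDeriv_centredXi_re_le_log hT2)
  have h3 := (sum_xiMult_le hRH (by norm_num : (0 : ℝ) < 2) s).trans logDeriv_centredXi_two_re_le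
  have h4 : ∑ γ ∈ s, (xiMult γ : ℝ) * zeroWeight T γ ≤
      2 / Real.pi * ∑ γ ∈ s, (xiMult γ : ℝ) * (∫ b in (2 : ℝ)..T, 1 / (b ^ 2 + (γ : ℝ) ^ 2)) +
      ∑ γ ∈ s, (xiMult γ : ℝ) * (T / (T ^ 2 + (γ : ℝ) ^ 2)) +
      4 * ∑ γ ∈ s, (xiMult γ : ℝ) * (2 / (2 ^ 2 + (γ : ℝ) ^ 2)) := by
    rw [Finset.mul_sum, Finset.mul_sum, ← Finset.sum_add_distrib, ← Finset.sum_add_distrib]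
    refine Finset.sum_le_sum fun γ _ => ?_
    refine (mul_le_mul_of_nonneg_left (zeroWeight_le hT2 γ) (Nat.cast_nonneg _)).trans
      (le_of_eq ?_)
    ring
  have h5 : 12 / 5 / T ≤ 0.0024 := by
    rw [div_le_iff₀ (by linarith)]
    linarith
  have h6 : 1 ≤ Real.log Real.pi := by
    rw [Real.le_log_iff_exp_le hpi]
    linarith [Real.exp_one_lt_d9, Real.pi_gt_d2]
  have h7 : 2 / Real.pi * (Real.log (T / (2 * Real.pi)) ^ 2 / 4 - 12 / 5 / T -
      (Real.log Real.pi ^ 2 / 4 - 6 / 5)) ≤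
      Real.log (T / (2 * Real.pi)) ^ 2 / (2 * Real.pi) + 0.606 := by
    have e : Real.log (T / (2 * Real.pi)) ^ 2 / (2 * Real.pi) =
        2 / Real.pi * (Real.log (T / (2 * Real.pi)) ^ 2 / 4) := by field_simp; ring
    rw [e]
    have h8 : 2 / Real.pi * 0.95 ≤ 0.606 := by
      rw [div_mul_eq_mul_div, div_le_iff₀ hpi]
      linarith [Real.pi_gt_d4]
    have h9 : 0 ≤ 12 / 5 / T := by positivity
    have h10 : 2 / Real.pi * (Real.log (T / (2 * Real.pi)) ^ 2 / 4 - 12 / 5 / T -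
      (Real.log Real.pi ^ 2 / 4 - 6 / 5)) ≤
      2 / Real.pi * (Real.log (T / (2 * Real.pi)) ^ 2 / 4 + 0.95) := by
      gcongr
      nlinarith
    linarith
  have h8 := mul_le_mul_of_nonneg_left h1 (by positivity : 0 ≤ 2 / Real.pi)
  linarith

theorem tsum_xiMult_half_le (hRH : RiemannHypothesis) :
    ∑' γ : XiZero, (xiMult γ : ℝ) * (1 / 2 / (1 / 4 + (γ : ℝ) ^ 2)) ≤ 2.5 := by
  have hs : Summable fun γ : XiZero => (xiMult γ : ℝ) * (1 / 2 / (1 / 4 + (γ : ℝ) ^ 2)) :=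
    ((summable_xiMult hRH).mul_left (1 / 4)).congr fun γ => by ring
  refine hs.tsum_le_of_sum_le fun s => ?_
  have h3 := (sum_xiMult_le hRH (by norm_num : (0 : ℝ) < 2) s).trans logDeriv_centredXi_two_re_le
  have h4 : ∑ γ ∈ s, (xiMult γ : ℝ) * (1 / 2 / (1 / 4 + (γ : ℝ) ^ 2)) ≤
      4 * ∑ γ ∈ s, (xiMult γ : ℝ) * (2 / (2 ^ 2 + (γ : ℝ) ^ 2)) := by
    rw [Finset.mul_sum]
    refine Finset.sum_le_sum fun γ _ => ?_
    rw [mul_left_comm]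
    refine mul_le_mul_of_nonneg_left ?_ (Nat.cast_nonneg _)
    rw [← mul_div_assoc, div_le_div_iff₀ (by positivity) (by positivity)]
    nlinarith [sq_nonneg (γ : ℝ)]
  linarith

end

section

open Filter Topology Metric Set MeasureTheory

/-- A bound for `|ψ(x) - x| / √x` in terms of `L = log x`. -/
noncomputable def psiMajorant (L : ℝ) : ℝ := L ^ 2 / (8 * Real.pi) - 0.297 * L + 8.26

theorem log_le_mul_sqrt {y : ℝ} (hy : 5400000 ≤ y) : Real.log y ≤ 0.0068 * √y := by
  have hy0 : 0 < y := by linarith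
  have hz : 2323 ≤ √y := Real.le_sqrt_of_sq_le (by norm_num; linarith)
  have hz0 : 0 < √y := by linarith
  have h1 : Real.log y = 2 * (Real.log (√y / 2048) + 11 * Real.log 2) := by
    rw [Real.log_div hz0.ne' (by norm_num), Real.log_sqrt hy0.le,
      show (2048 : ℝ) = 2 ^ 11 by norm_num, Real.log_pow]
    push_cast
    ring
  have h2 := Real.log_le_sub_one_of_pos (x := √y / 2048) (by positivity)
  linarith [Real.log_two_lt_d9]

theorem log_ten_pi_ge : 3.44 ≤ Real.log (10 * Real.pi) := by
  rw [Real.le_log_iff_exp_le (by positivity)]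
  have h1 : Real.exp 3.44 < 31.4 := by
    refine lt_of_pow_lt_pow_left₀ 25 (by norm_num) ?_
    rw [← Real.exp_nat_mul, show ((25 : ℕ) : ℝ) * 3.44 = (86 : ℕ) * 1 by norm_num,
      Real.exp_nat_mul]
    refine lt_trans (pow_lt_pow_left₀ Real.exp_one_lt_d9 (Real.exp_pos _).le (by norm_num)) ?_
    norm_num
  linarith [Real.pi_gt_d2]

theorem exp_sub_bounds {w : ℝ} (hw : 0 < w) (hw1 : w ≤ 1) :
    Real.exp w - 1 ≤ w * (1 + w / 2 + w ^ 2) ∧ w * (1 - w / 2 - w ^ 2) ≤ 1 - Real.exp (-w) := by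
  have h1 := Real.exp_bound (x := w) (by rwa [abs_of_pos hw]) (n := 3) (by norm_num)
  have h2 := Real.exp_bound (x := -w) (by rwa [abs_neg, abs_of_pos hw]) (n := 3) (by norm_num)
  rw [abs_le] at h1 h2
  simp only [Finset.sum_range_succ, Finset.sum_range_zero, abs_neg, abs_of_pos hw] at h1 h2
  norm_num [Nat.factorial] at h1 h2
  have h3 : 0 < w ^ 3 := by positivity
  constructor
  · nlinarith [h1.2]
  · nlinarith [h2.2]

theorem abs_psi_sub_le (hRH : RiemannHypothesis) {X : ℝ} (hX : 3 * 10 ^ 13 ≤ X) :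
    |Chebyshev.psi X - X| ≤ √X * psiMajorant (Real.log X) := by
  have hX0 : 0 < X := by linarith
  have hpi := Real.pi_pos
  set y := √X with hy
  have hyX : y ^ 2 = X := Real.sq_sqrt hX0.le
  have hy1 : 5400000 ≤ y := Real.le_sqrt_of_sq_le (by norm_num; linarith)
  have hy0 : 0 < y := by linarith
  set u := Real.log X with hu
  have hexp : Real.exp u = X := Real.exp_log hX0
  have hexp2 : Real.exp (u / 2) = y := by
    rw [← Real.sqrt_sq (Real.exp_pos (u / 2)).le, ← Real.exp_nat_mul]
    rw [show ((2 : ℕ) : ℝ) * (u / 2) = u by push_cast; ring, hexp]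
  have hu1 : 20 ≤ u := by
    rw [hu, Real.le_log_iff_exp_le hX0, show (20 : ℝ) = (20 : ℕ) * 1 by norm_num,
      Real.exp_nat_mul]
    refine le_trans (pow_le_pow_left₀ (Real.exp_pos _).le Real.exp_one_lt_d9.le 20) ?_
    refine le_trans ?_ hX
    norm_num
  set w := 10 / y with hw
  have hw0 : 0 < w := by positivity
  have hw1 : w ≤ 1 := by
    rw [hw, div_le_one hy0]
    linarith
  have hwy : w * y = 10 := by rw [hw]; field_simp
  have hT : y / 5 * w = 2 := by linarith
  obtain ⟨hup, -⟩ := psiIntegral_sub_bounds hRH (v := u) (by linarith) hw0 hT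
  obtain ⟨-, hlo⟩ := psiIntegral_sub_bounds hRH (v := u - w) (by linarith) hw0 hT
  have hS := sum_zeroWeight_le hRH (T := y / 5) (by linarith)
  have hS2 := tsum_xiMult_half_le hRH
  have hS0 : 0 ≤ ∑' γ : XiZero, (xiMult γ : ℝ) * zeroWeight (y / 5) γ :=
    tsum_nonneg fun γ => mul_nonneg (Nat.cast_nonneg _) (zeroWeight_nonneg (by positivity) _)
  generalize (∑' γ : XiZero, (xiMult γ : ℝ) * zeroWeight (y / 5) γ) = S at *
  generalize (∑' γ : XiZero, (xiMult γ : ℝ) * (1 / 2 / (1 / 4 + (γ : ℝ) ^ 2))) = S2 at *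
  have hψ1 := mul_psi_le (u := u) hw0.le
  have hψ2 := le_mul_psi (u := u) hw0.le
  rw [hexp] at hψ1 hψ2
  generalize Chebyshev.psi X = P at *
  simp only [sub_add_cancel] at hlo
  rw [hexp, Real.exp_add, hexp, add_div, Real.exp_add, hexp2] at hup
  rw [hexp, sub_eq_add_neg u w, Real.exp_add, hexp, hexp2, ← sub_eq_add_neg u w] at hlo
  obtain ⟨e1, e2⟩ := exp_sub_bounds hw0 hw1
  have e3 : Real.exp (w / 2) ≤ 1 + w := by
    have := (exp_sub_bounds (w := w / 2) (by positivity) (by linarith)).1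
    nlinarith
  have hXw : X * w = 10 * y := by rw [← hyX]; linear_combination y * hwy
  have hXw2 : X * w ^ 2 = 100 := by rw [← hyX]; linear_combination (w * y + 10) * hwy
  have hP1 : P - X ≤ y * (5 + S) + 10 * S + 103 := by
    have h1 : w * P ≤ w * (X * (1 + w / 2 + w ^ 2) + (y * (1 + w) * S + 2.5)) := by
      have h2 : X * (Real.exp w - 1) ≤ X * (w * (1 + w / 2 + w ^ 2)) := by gcongr
      have h3 : w * (y * Real.exp (w / 2) * S + S2) ≤ w * (y * (1 + w) * S + 2.5) := by gcongr
      linarith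
    have h4 := le_of_mul_le_mul_left h1 hw0
    have h5 : y * (1 + w) * S = y * S + 10 * S := by linear_combination S * hwy
    rw [h5] at h4
    linarith
  have hP2 : X - P ≤ y * (5 + S) + 106 := by
    have h1 : w * (X * (1 - w / 2 - w ^ 2) - 3 - (y * S + 2.5)) ≤ w * P := by
      have h2 : X * (w * (1 - w / 2 - w ^ 2)) ≤ X * (1 - Real.exp (-w)) := by gcongr
      have h3 : w * (y * S + S2) ≤ w * (y * S + 2.5) := by gcongr
      linarith
    have h4 := le_of_mul_le_mul_left h1 hw0
    linarith
  have hP : |P - X| ≤ y * (5 + S) + 10 * S + 106 := by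
    rw [abs_le]
    constructor <;> linarith
  refine hP.trans ?_
  have hℓ : Real.log (y / 5 / (2 * Real.pi)) = u / 2 - Real.log (10 * Real.pi) := by
    rw [show y / 5 / (2 * Real.pi) = y / (10 * Real.pi) by field_simp; norm_num,
      Real.log_div hy0.ne' (by positivity), hy, Real.log_sqrt hX0.le]
  rw [hℓ] at hS
  have hten := log_ten_pi_ge
  have hten2 : Real.log (10 * Real.pi) ≤ 4 := by
    rw [Real.log_le_iff_le_exp (by positivity), show (4 : ℝ) = (4 : ℕ) * 1 by norm_num,
      Real.exp_nat_mul]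
    have := pow_le_pow_left₀ (by norm_num) Real.exp_one_gt_d9.le 4
    refine le_trans ?_ this
    linarith [Real.pi_lt_d2]
  generalize Real.log (10 * Real.pi) = c at *
  have hS3 : S ≤ u ^ 2 / (8 * Real.pi) - 0.297 * u + 3.245 := by
    have h1 : (u / 2 - c) ^ 2 ≤ (u / 2 - 3.44) ^ 2 := by
      apply pow_le_pow_left₀ <;> linarith
    have h2 : (u / 2 - c) ^ 2 / (2 * Real.pi) ≤ (u / 2 - 3.44) ^ 2 / (2 * Real.pi) := by gcongr
    have h3 : (u / 2 - 3.44) ^ 2 / (2 * Real.pi) = u ^ 2 / (8 * Real.pi) -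
        (3.44 * u - 11.8336) * (1 / (2 * Real.pi)) := by field_simp; ring
    have h4 : 0.15915 ≤ 1 / (2 * Real.pi) := by
      rw [le_div_iff₀ (by positivity)]
      linarith [Real.pi_lt_d4]
    have h5 : (3.44 * u - 11.8336) * 0.15915 ≤ (3.44 * u - 11.8336) * (1 / (2 * Real.pi)) := by
      gcongr
      linarith
    linarith
  have hlog : u ≤ 0.0136 * √y := by
    have := log_le_mul_sqrt hy1
    rw [hy, Real.log_sqrt hX0.le] at this
    linarith
  have hu2 : u ^ 2 ≤ 0.0002 * y := by
    have h1 : u ^ 2 ≤ (0.0136 * √y) ^ 2 := by gcongr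
    rw [mul_pow, Real.sq_sqrt hy0.le] at h1
    linarith
  have hS4 : 10 * S + 106 ≤ 0.01 * y := by
    have h1 : u ^ 2 / (8 * Real.pi) ≤ u ^ 2 / 24 := by
      gcongr
      linarith [Real.pi_gt_three]
    linarith
  rw [psiMajorant]
  nlinarith

/-- A bound for `|θ(x) - x| / √x` in terms of `L = log x`. -/
noncomputable def thetaMajorant (L : ℝ) : ℝ := L ^ 2 / (8 * Real.pi) - 0.297 * L + 9.8

end

section

open MeasureTheory Set

/-- The passage from `ψ` to `θ` costs at most `1.54 √X`. -/
lemma psi_sub_theta_le {X : ℝ} (hX : 3 * 10 ^ 13 ≤ X) :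
    Chebyshev.psi X - Chebyshev.theta X ≤ 1.54 * √X := by
  have hX0 : 0 < X := by linarith
  have hX1 : 1 ≤ X := by linarith
  set w := √X with hw
  have hw2 : w ^ 2 = X := Real.sq_sqrt hX0.le
  have hw1 : 5400000 ≤ w := by
    rw [hw]; apply Real.le_sqrt_of_sq_le; linarith
  have hw0 : 0 < w := by linarith
  set c := X ^ (3 : ℝ)⁻¹ with hc
  have hc0 : 0 < c := by positivity
  have hc1 : 1 ≤ c := Real.one_le_rpow hX1 (by norm_num)
  have hc3 : c ^ 3 = w ^ 2 := by
    rw [hw2, hc, ← Real.rpow_natCast, ← Real.rpow_mul hX0.le]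
    norm_num
  have hcw : c ≤ 0.0058 * w := by
    apply le_of_pow_le_pow_left₀ (n := 3) (by norm_num) (by positivity)
    rw [hc3]
    nlinarith [sq_nonneg w, mul_le_mul_of_nonneg_right hw1 (sq_nonneg w)]
  have hlog4 : Real.log 4 ≤ 1.3863 := by
    rw [show (4 : ℝ) = 2 ^ 2 by norm_num, Real.log_pow]
    push_cast
    linarith [Real.log_two_lt_d9]
  have h1 : Chebyshev.psi w ≤ 1.4 * w := by
    have h := Chebyshev.psi_le (x := w) (by linarith)
    have h2 : 2 * √w * Real.log w ≤ 2 * √w * (0.0068 * √w) := by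
      gcongr
      exact log_le_mul_sqrt hw1
    nlinarith [Real.sq_sqrt hw0.le]
  have h2 : Chebyshev.psi c ≤ 5.4 * c := by
    have h := Chebyshev.psi_le hc1
    have h2 : 2 * √c * Real.log c ≤ 2 * √c * (2 * √c) := by
      gcongr
      have := Real.log_le_sub_one_of_pos (Real.sqrt_pos.2 hc0)
      rw [Real.log_sqrt hc0.le] at this
      linarith
    nlinarith [Real.sq_sqrt hc0.le]
  have h3 : Chebyshev.psi (X ^ (5 : ℝ)⁻¹) ≤ Chebyshev.psi c :=
    Chebyshev.psi_mono (Real.rpow_le_rpow_of_exponent_le hX1 (by norm_num))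
  have h4 := Chebyshev.psi_sub_theta_le_psi_add_psi_add_psi X
  rw [show X ^ (2 : ℝ)⁻¹ = w by rw [hw, Real.sqrt_eq_rpow]; norm_num, ← hc] at h4
  linarith

lemma abs_theta_sub_le (hRH : RiemannHypothesis) {X : ℝ} (hX : 3 * 10 ^ 13 ≤ X) :
    |Chebyshev.theta X - X| ≤ √X * thetaMajorant (Real.log X) := by
  have h1 := abs_le.1 (abs_psi_sub_le hRH hX)
  have h2 := psi_sub_theta_le hX
  have h3 := Chebyshev.theta_le_psi X
  have h4 : √X * thetaMajorant (Real.log X) = √X * psiMajorant (Real.log X) + 1.54 * √X := by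
    rw [thetaMajorant, psiMajorant]; ring
  rw [h4, abs_le]
  constructor <;> linarith [Real.sqrt_nonneg X]

lemma thetaMajorant_le_thetaMajorant {a b : ℝ} (ha : 4 ≤ a) (hab : a ≤ b) :
    thetaMajorant a ≤ thetaMajorant b := by
  have h : 0 ≤ (b - a) * ((a + b) / (8 * Real.pi) - 0.297) := by
    apply mul_nonneg (by linarith)
    rw [sub_nonneg, le_div_iff₀ (by positivity)]
    linarith [Real.pi_lt_d4]
  have h2 : thetaMajorant b - thetaMajorant a =
      (b - a) * ((a + b) / (8 * Real.pi) - 0.297) := by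
    rw [thetaMajorant, thetaMajorant]; ring
  linarith

lemma primePi_eq_primeCounting (x : ℝ) : primePi x = Nat.primeCounting ⌊x⌋₊ := by
  rw [primePi, Nat.primeCounting, Nat.primeCounting', Nat.count_eq_card_filter_range]

lemma continuousOn_inv_log {a b : ℝ} (ha : 2 ≤ a) :
    ContinuousOn (fun t => (Real.log t)⁻¹) (Icc a b) := by
  apply ContinuousOn.inv₀
  · exact Real.continuousOn_log.mono fun t ht => by
      have := ht.1
      simp only [mem_compl_iff, mem_singleton_iff]
      linarith
  · intro t ht
    exact (Real.log_pos (by linarith [ht.1])).ne'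

lemma intervalIntegrable_inv_log {a b : ℝ} (ha : 2 ≤ a) (hab : a ≤ b) :
    IntervalIntegrable (fun t => (Real.log t)⁻¹) volume a b := by
  apply ContinuousOn.intervalIntegrable
  rw [uIcc_of_le hab]
  exact continuousOn_inv_log ha

/-- On an interval where `|θ(t) - t| ≤ E`, the number of primes differs from the logarithmic
integral by at most `2 E / log a`. -/
lemma abs_primePi_sub_le {a b E : ℝ} (ha : 2 ≤ a) (hab : a ≤ b)
    (hE : ∀ t ∈ Icc a b, |Chebyshev.theta t - t| ≤ E) :
    |(primePi b : ℝ) - primePi a - ∫ t in a..b, (Real.log t)⁻¹| ≤ 2 * E / Real.log a := by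
  have hla : 0 < Real.log a := Real.log_pos (by linarith)
  have hlb : 0 < Real.log b := Real.log_pos (by linarith)
  have hpos : ∀ t ∈ Icc a b, 0 < t ∧ 0 < Real.log t := fun t ht =>
    ⟨by linarith [ht.1], Real.log_pos (by linarith [ht.1])⟩
  have hI : ∀ c d, 2 ≤ c → c ≤ d → IntervalIntegrable
      (fun t => Chebyshev.theta t / (t * Real.log t ^ 2)) volume c d := by
    intro c d hc hcd
    rw [intervalIntegrable_iff_integrableOn_Icc_of_le hcd]
    exact (Chebyshev.integrableOn_theta_div_id_mul_log_sq d).mono_set (Icc_subset_Icc_left hc)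
  have hcont : ContinuousOn (fun t => (Real.log t ^ 2)⁻¹) (Icc a b) := by
    have := (continuousOn_inv_log (b := b) ha).pow 2
    exact this.congr fun t _ => by simp
  have hI2 : IntervalIntegrable (fun t => (Real.log t ^ 2)⁻¹) volume a b := by
    apply ContinuousOn.intervalIntegrable
    rwa [uIcc_of_le hab]
  have hI3 : IntervalIntegrable (fun t => (t * Real.log t ^ 2)⁻¹) volume a b := by
    apply ContinuousOn.intervalIntegrable
    rw [uIcc_of_le hab]
    exact ((continuousOn_inv₀.mono fun t ht => (hpos t ht).1.ne').mul hcont).congr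
      fun t _ => by simp [mul_comm]
  have hmain : ∫ t in a..b, ((Real.log t)⁻¹ - (Real.log t ^ 2)⁻¹) =
      b / Real.log b - a / Real.log a := by
    apply intervalIntegral.integral_eq_sub_of_hasDerivAt
    · intro t ht
      rw [uIcc_of_le hab] at ht
      obtain ⟨h1, h2⟩ := hpos t ht
      refine ((hasDerivAt_id t).div (Real.hasDerivAt_log h1.ne') h2.ne').congr_deriv ?_
      simp only [id]
      field_simp
    · exact (intervalIntegrable_inv_log ha hab).sub hI2
  have herr : ∫ t in a..b, (t * Real.log t ^ 2)⁻¹ = (Real.log a)⁻¹ - (Real.log b)⁻¹ := by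
    rw [show (Real.log a)⁻¹ - (Real.log b)⁻¹ = -(Real.log b)⁻¹ - -(Real.log a)⁻¹ by ring]
    apply intervalIntegral.integral_eq_sub_of_hasDerivAt
      (f := fun t => -(Real.log t)⁻¹) _ hI3
    intro t ht
    rw [uIcc_of_le hab] at ht
    obtain ⟨h1, h2⟩ := hpos t ht
    refine ((Real.hasDerivAt_log h1.ne').inv h2.ne').neg.congr_deriv ?_
    field_simp
  have hsplit : (primePi b : ℝ) - primePi a - ∫ t in a..b, (Real.log t)⁻¹ =
      (Chebyshev.theta b - b) / Real.log b - (Chebyshev.theta a - a) / Real.log a +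
      ∫ t in a..b, (Chebyshev.theta t / (t * Real.log t ^ 2) - (Real.log t ^ 2)⁻¹) := by
    rw [intervalIntegral.integral_sub (intervalIntegrable_inv_log ha hab) hI2] at hmain
    rw [intervalIntegral.integral_sub (hI a b ha hab) hI2, primePi_eq_primeCounting,
      primePi_eq_primeCounting, Chebyshev.primeCounting_eq_theta_div_log_add_integral ha,
      Chebyshev.primeCounting_eq_theta_div_log_add_integral (ha.trans hab),
      ← intervalIntegral.integral_add_adjacent_intervals (hI 2 a le_rfl ha) (hI a b ha hab),
      sub_div, sub_div]
    linarith
  have hint : |∫ t in a..b, (Chebyshev.theta t / (t * Real.log t ^ 2) - (Real.log t ^ 2)⁻¹)| ≤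
      E * ((Real.log a)⁻¹ - (Real.log b)⁻¹) := by
    rw [← herr, ← intervalIntegral.integral_const_mul, ← Real.norm_eq_abs]
    apply intervalIntegral.norm_integral_le_of_norm_le hab _ (hI3.const_mul E)
    refine Filter.Eventually.of_forall fun t ht => ?_
    have ht' := Ioc_subset_Icc_self ht
    obtain ⟨h1, h2⟩ := hpos t ht'
    rw [show Chebyshev.theta t / (t * Real.log t ^ 2) - (Real.log t ^ 2)⁻¹ =
      (Chebyshev.theta t - t) * (t * Real.log t ^ 2)⁻¹ by field_simp, norm_mul,
      Real.norm_eq_abs, Real.norm_of_nonneg (by positivity)]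
    gcongr
    exact hE t ht'
  have hb : |(Chebyshev.theta b - b) / Real.log b| ≤ E / Real.log b := by
    rw [abs_div, abs_of_pos hlb]
    gcongr
    exact hE b ⟨hab, le_rfl⟩
  have ha' : |(Chebyshev.theta a - a) / Real.log a| ≤ E / Real.log a := by
    rw [abs_div, abs_of_pos hla]
    gcongr
    exact hE a ⟨le_rfl, hab⟩
  rw [hsplit]
  calc _ ≤ E / Real.log b + E / Real.log a + E * ((Real.log a)⁻¹ - (Real.log b)⁻¹) :=
        (abs_add_le _ _).trans (add_le_add ((abs_sub _ _).trans (add_le_add hb ha')) hint)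
    _ = _ := by ring

lemma inv_log_sub_inv_log_ge {Y v : ℝ} (hv : 0 ≤ v) (h2 : 2 ≤ Y - v) :
    2 * v / (Y * Real.log Y ^ 2) ≤ (Real.log (Y - v))⁻¹ - (Real.log (Y + v))⁻¹ := by
  have hY : 0 < Y := by linarith
  have hlY : 0 < Real.log Y := Real.log_pos (by linarith)
  have hp : 0 < Real.log (Y - v) := Real.log_pos (by linarith)
  have hq : 0 < Real.log (Y + v) := Real.log_pos (by linarith)
  have hsum : Real.log (Y - v) + Real.log (Y + v) ≤ 2 * Real.log Y := by
    rw [← Real.log_mul (by linarith) (by linarith),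
      show 2 * Real.log Y = Real.log (Y ^ 2) by rw [Real.log_pow]; norm_num]
    apply Real.log_le_log (mul_pos (by linarith) (by linarith))
    nlinarith [sq_nonneg v]
  have hprod : Real.log (Y - v) * Real.log (Y + v) ≤ Real.log Y ^ 2 := by
    nlinarith [sq_nonneg (Real.log (Y - v) - Real.log (Y + v))]
  have hdiff : 2 * v / Y ≤ Real.log (Y + v) - Real.log (Y - v) := by
    rcases hv.eq_or_lt with rfl | hv
    · simp
    · have h := Real.hasSum_log_sub_log_of_abs_lt_one (x := v / Y)
        (by rw [abs_of_pos (by positivity), div_lt_one hY]; linarith)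
      have h0 := h.summable.le_tsum 0 (fun j _ => by positivity)
      rw [h.tsum_eq] at h0
      have e1 : 1 + v / Y = (Y + v) / Y := by field_simp
      have e2 : 1 - v / Y = (Y - v) / Y := by field_simp
      rw [e1, e2, Real.log_div (by linarith) hY.ne', Real.log_div (by linarith) hY.ne'] at h0
      norm_num at h0
      calc 2 * v / Y = 2 * (v / Y) := by ring
        _ ≤ _ := by linarith
  calc 2 * v / (Y * Real.log Y ^ 2) = (2 * v / Y) / Real.log Y ^ 2 := by field_simp
    _ ≤ (Real.log (Y + v) - Real.log (Y - v)) / (Real.log (Y - v) * Real.log (Y + v)) := by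
        gcongr
        exact (div_nonneg (by linarith) hY.le).trans hdiff
    _ = _ := by field_simp

lemma integral_inv_log_sub_ge {Y H : ℝ} (hH : 0 ≤ H) (h2 : 2 ≤ Y - H) :
    H ^ 2 / (Y * Real.log Y ^ 2) ≤
      (∫ t in (Y - H)..Y, (Real.log t)⁻¹) - ∫ t in Y..(Y + H), (Real.log t)⁻¹ := by
  have e1 : ∫ t in (Y - H)..Y, (Real.log t)⁻¹ = ∫ v in (0 : ℝ)..H, (Real.log (Y - v))⁻¹ := by
    rw [intervalIntegral.integral_comp_sub_left (fun t => (Real.log t)⁻¹) Y, sub_zero]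
  have e2 : ∫ t in Y..(Y + H), (Real.log t)⁻¹ = ∫ v in (0 : ℝ)..H, (Real.log (Y + v))⁻¹ := by
    rw [intervalIntegral.integral_comp_add_left (fun t => (Real.log t)⁻¹) Y, add_zero]
  have i1 : IntervalIntegrable (fun v => (Real.log (Y - v))⁻¹) volume 0 H := by
    apply ContinuousOn.intervalIntegrable
    rw [uIcc_of_le hH]
    exact (continuousOn_inv_log (a := Y - H) (b := Y) h2).comp (by fun_prop)
      fun v hv => ⟨by linarith [hv.2], by linarith [hv.1]⟩
  have i2 : IntervalIntegrable (fun v => (Real.log (Y + v))⁻¹) volume 0 H := by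
    apply ContinuousOn.intervalIntegrable
    rw [uIcc_of_le hH]
    exact (continuousOn_inv_log (a := Y) (b := Y + H) (by linarith)).comp (by fun_prop)
      fun v hv => ⟨by linarith [hv.1], by linarith [hv.2]⟩
  rw [e1, e2, ← intervalIntegral.integral_sub i1 i2]
  have e3 : ∫ v in (0 : ℝ)..H, 2 * v / (Y * Real.log Y ^ 2) = H ^ 2 / (Y * Real.log Y ^ 2) := by
    rw [intervalIntegral.integral_div, intervalIntegral.integral_const_mul, integral_id]
    ring
  rw [← e3]
  apply intervalIntegral.integral_mono_on hH
  · exact ((continuous_const.mul continuous_id).div_const _).intervalIntegrable _ _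
  · exact i1.sub i2
  · exact fun v hv => inv_log_sub_inv_log_ge hv.1 (by linarith [hv.2])

/-- Lower bound for the second difference of the prime counting function. -/
lemma second_difference_ge {Y H E : ℝ} (hH : 0 ≤ H) (h2 : 2 ≤ Y - H)
    (hE : ∀ t ∈ Icc (Y - H) (Y + H), |Chebyshev.theta t - t| ≤ E) :
    H ^ 2 / (Y * Real.log Y ^ 2) - 4 * E / Real.log (Y - H) ≤
      2 * (primePi Y : ℝ) - primePi (Y - H) - primePi (Y + H) := by
  have hE0 : 0 ≤ E := (abs_nonneg _).trans (hE Y ⟨by linarith, by linarith⟩)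
  have h3 := abs_le.1 (abs_primePi_sub_le h2 (by linarith : Y - H ≤ Y)
    fun t ht => hE t ⟨ht.1, by linarith [ht.2]⟩)
  have h4 := abs_le.1 (abs_primePi_sub_le (by linarith : 2 ≤ Y) (by linarith : Y ≤ Y + H)
    fun t ht => hE t ⟨by linarith [ht.1], ht.2⟩)
  have h5 := integral_inv_log_sub_ge hH h2
  have h6 : 2 * E / Real.log Y ≤ 2 * E / Real.log (Y - H) := by
    have : 0 < Real.log (Y - H) := Real.log_pos (by linarith)
    gcongr
    · linarith
  have h7 : 4 * E / Real.log (Y - H) = 2 * E / Real.log (Y - H) + 2 * E / Real.log (Y - H) := by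
    ring
  linarith [h3.1, h4.2]

end

section

open Set

lemma log_three_mul_ten_pow_le : Real.log (3 * 10 ^ 13) ≤ 31.0323 := by
  rw [Real.log_mul (by norm_num) (by norm_num), Real.log_pow,
    show (10 : ℝ) = 2 * 5 by norm_num, Real.log_mul (by norm_num) (by norm_num)]
  push_cast
  linarith [Real.log_two_lt_d9, Real.log_three_lt_d9, Real.log_five_lt_d9]

lemma log_le_tangent_thirty_two {x : ℝ} (hx : 0 < x) :
    Real.log x ≤ 2.46574 + x / 32 := by
  have h := Real.log_le_sub_one_of_pos (x := x / 32) (by positivity)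
  rw [Real.log_div hx.ne' (by norm_num), show (32 : ℝ) = 2 ^ 5 by norm_num, Real.log_pow] at h
  push_cast at h
  linarith [Real.log_two_lt_d9]

lemma sqrt_le_tangent {x : ℝ} (hx : 0 ≤ x) : √x ≤ 5 / 59 * x + 2.95 := by
  nlinarith [Real.sq_sqrt hx, sq_nonneg (√x - 5.9)]

/-- The numerical inequality on which the threshold `3 * 10 ^ 13` rests. -/
lemma threshold_lt_sqrt {K : ℝ} (hK : 3 * 10 ^ 13 ≤ K) {L l : ℝ}
    (hL : L = Real.log (K * Real.log K)) (hl : l = Real.log (K * L)) :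
    16 * (L - 0.475) * √L * l * thetaMajorant l < √K := by
  have hK0 : 0 < K := by linarith
  set y := Real.log K with hy
  have hz := log_three_mul_ten_pow_le
  set z := Real.log (3 * 10 ^ 13) with hz'
  set t := y - z with ht
  have ht0 : 0 ≤ t := sub_nonneg.2 (Real.log_le_log (by norm_num) hK)
  have hy31 : y ≤ 31.0323 + t := by linarith
  have hy1 : 30 ≤ y := by
    have : 30 ≤ z := by
      rw [hz', Real.log_mul (by norm_num) (by norm_num), Real.log_pow,
        show (10 : ℝ) = 2 * 5 by norm_num, Real.log_mul (by norm_num) (by norm_num)]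
      push_cast
      linarith [Real.log_two_gt_d9, Real.log_three_gt_d9, Real.log_five_gt_d9]
    linarith
  have hLy : L = y + Real.log y := by
    rw [hL, Real.log_mul hK0.ne' (by linarith)]
  have hly0 : 0 ≤ Real.log y := Real.log_nonneg (by linarith)
  have hL30 : 30 ≤ L := by linarith
  have hly : l = y + Real.log L := by
    rw [hl, Real.log_mul hK0.ne' (by linarith)]
  have hlL0 : 0 ≤ Real.log L := Real.log_nonneg (by linarith)
  have hLt : L ≤ 34.468 + 1.03125 * t := by
    linarith [log_le_tangent_thirty_two (show 0 < y by linarith)]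
  have hlt : l ≤ 34.5756 + 1.0324 * t := by
    linarith [log_le_tangent_thirty_two (show 0 < L by linarith)]
  have hsL : √L ≤ 5.872 + 0.0875 * t := by
    linarith [sqrt_le_tangent (show 0 ≤ L by linarith)]
  have hB : thetaMajorant l ≤ 47.12 + 2.55 * t + 0.0425 * t ^ 2 := by
    refine (thetaMajorant_le_thetaMajorant (by linarith) hlt).trans ?_
    have h1 : (34.5756 + 1.0324 * t) ^ 2 / (8 * Real.pi) ≤
        (34.5756 + 1.0324 * t) ^ 2 / 25.132 := by
      gcongr
      linarith [Real.pi_gt_d4]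
    rw [thetaMajorant]
    have h2 : (34.5756 + 1.0324 * t) ^ 2 / 25.132 ≤
      47.58 + 2.842 * t + 0.0425 * t ^ 2 := by
      rw [div_le_iff₀ (by norm_num)]
      nlinarith [sq_nonneg t]
    linarith
  have hB0 : 0 ≤ thetaMajorant l := by
    have h1 := thetaMajorant_le_thetaMajorant (a := 20) (b := l) (by norm_num) (by linarith)
    have h2 : 0 ≤ thetaMajorant 20 := by
      rw [thetaMajorant]
      have : 0 ≤ (20 : ℝ) ^ 2 / (8 * Real.pi) := by positivity
      linarith
    linarith
  have hsqrt : √K = √(3 * 10 ^ 13) * Real.exp (t / 2) := by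
    have h1 : K = 3 * 10 ^ 13 * Real.exp t := by
      rw [ht, hy, hz', Real.exp_sub, Real.exp_log hK0, Real.exp_log (by norm_num)]
      field_simp
    rw [h1, Real.sqrt_mul (by norm_num), Real.exp_half]
  have hs0 : 5477000 ≤ √(3 * 10 ^ 13 : ℝ) := Real.le_sqrt_of_sq_le (by norm_num)
  have hexp : 1 + t / 2 + t ^ 2 / 8 + t ^ 3 / 48 + t ^ 4 / 384 + t ^ 5 / 3840 ≤
      Real.exp (t / 2) := by
    have h := Real.sum_le_exp_of_nonneg (x := t / 2) (by linarith) 6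
    simp only [Finset.sum_range_succ, Finset.sum_range_zero, Nat.factorial] at h
    push_cast at h
    linarith
  calc 16 * (L - 0.475) * √L * l * thetaMajorant l
      ≤ 16 * (33.993 + 1.03125 * t) * (5.872 + 0.0875 * t) * (34.5756 + 1.0324 * t) *
        (47.12 + 2.55 * t + 0.0425 * t ^ 2) := by
        gcongr
        · linarith
        · linarith
    _ < 5477000 * (1 + t / 2 + t ^ 2 / 8 + t ^ 3 / 48 + t ^ 4 / 384 + t ^ 5 / 3840) := by
        rw [← sub_pos]
        ring_nf
        positivity
    _ ≤ √(3 * 10 ^ 13) * Real.exp (t / 2) := by gcongr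
    _ = √K := hsqrt.symm

/-- The second difference is positive once `√k` beats the error term. -/
lemma second_difference_pos_of_threshold (hRH : RiemannHypothesis) {K n : ℝ}
    (hK : 3 * 10 ^ 13 ≤ K) (hn : 1 ≤ n) (hnL : n ≤ Real.log (K * Real.log K) - 1) :
    0 < 2 * (primePi (n * K + K / 2) : ℝ) - primePi (n * K) - primePi (n * K + K) := by
  have hK0 : 0 < K := by linarith
  set L := Real.log (K * Real.log K) with hL
  set l := Real.log (K * L) with hl
  have hthr := threshold_lt_sqrt hK hL hl
  have hKn : K ≤ n * K := by nlinarith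
  set Y := n * K + K / 2 with hY
  have hY0 : 0 < Y := by linarith
  have hZ : n * K + K ≤ K * L := by nlinarith
  set B := thetaMajorant l with hB
  have hE : ∀ t ∈ Icc (Y - K / 2) (Y + K / 2), |Chebyshev.theta t - t| ≤ √(K * L) * B := by
    intro t ht
    have h1 : 3 * 10 ^ 13 ≤ t := by linarith [ht.1]
    have h2 : t ≤ K * L := by linarith [ht.2]
    have h3 : 4 ≤ Real.log t := by
      rw [Real.le_log_iff_exp_le (by linarith)]
      have : Real.exp 4 ≤ 3 ^ 4 := by
        rw [show (4 : ℝ) = (4 : ℕ) * 1 by norm_num, Real.exp_nat_mul]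
        gcongr
        exact Real.exp_one_lt_three.le
      linarith
    refine (abs_theta_sub_le hRH h1).trans ?_
    refine mul_le_mul (Real.sqrt_le_sqrt h2)
      (thetaMajorant_le_thetaMajorant h3 (Real.log_le_log (by linarith) h2)) ?_
      (Real.sqrt_nonneg _)
    by_contra! hneg
    have := (abs_nonneg _).trans (abs_theta_sub_le hRH h1)
    have hs : 0 < √t := Real.sqrt_pos.2 (by linarith)
    nlinarith
  have hmain := second_difference_ge (Y := Y) (H := K / 2) (by linarith) (by linarith) hE
  rw [show Y - K / 2 = n * K by rw [hY]; ring, show Y + K / 2 = n * K + K by rw [hY]; ring]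
    at hmain
  refine lt_of_lt_of_le ?_ hmain
  set a := Real.log (n * K) with ha
  have ha30 : 30 ≤ a := by
    have h1 : (30 : ℝ) ≤ Real.log (3 * 10 ^ 13) := by
      rw [Real.log_mul (by norm_num) (by norm_num), Real.log_pow,
        show (10 : ℝ) = 2 * 5 by norm_num, Real.log_mul (by norm_num) (by norm_num)]
      push_cast
      linarith [Real.log_two_gt_d9, Real.log_three_gt_d9, Real.log_five_gt_d9]
    exact h1.trans (Real.log_le_log (by norm_num) (by linarith))
  set b := Real.log Y with hb
  have hbl : b ≤ l := Real.log_le_log hY0 (by linarith)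
  have hab : b ≤ a + 1 / (2 * n) := by
    have h1 : Y = n * K * (1 + 1 / (2 * n)) := by rw [hY]; field_simp
    rw [hb, h1, Real.log_mul (by positivity) (by positivity)]
    have := Real.log_le_sub_one_of_pos (x := 1 + 1 / (2 * n)) (by positivity)
    linarith
  have hb30 : 30 ≤ b := ha30.trans (Real.log_le_log (by positivity) (by linarith))
  have hratio : (n + 1 / 2) * b ≤ (L - 0.475) * a := by
    have h1 : (n + 1 / 2) * b ≤ (n + 1 / 2) * a + (1 / 2 + 1 / (4 * n)) := by
      calc (n + 1 / 2) * b ≤ (n + 1 / 2) * (a + 1 / (2 * n)) := by gcongr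
        _ = _ := by field_simp; ring
    have h2 : 1 / (4 * n) ≤ 1 / 4 := by
      gcongr
      linarith
    nlinarith
  have hB0 : 0 ≤ B := by
    have := (abs_nonneg _).trans (hE Y ⟨by linarith, by linarith⟩)
    exact nonneg_of_mul_nonneg_right this (Real.sqrt_pos.2 (by nlinarith))
  have hs : √K * √K = K := Real.mul_self_sqrt hK0.le
  rw [sub_pos, div_lt_div_iff₀ (by linarith) (by positivity)]
  calc 4 * (√(K * L) * B) * (Y * b ^ 2)
      = K / 4 * √K * (16 * √L * B * ((n + 1 / 2) * b * b)) := by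
        rw [Real.sqrt_mul hK0.le, hY]; ring
    _ ≤ K / 4 * √K * (16 * √L * B * ((L - 0.475) * a * l)) := by
        gcongr
        nlinarith
    _ = K / 4 * √K * a * (16 * (L - 0.475) * √L * l * B) := by ring
    _ < K / 4 * √K * a * √K := by gcongr
    _ = (K / 2) ^ 2 * a := by linear_combination (K / 4 * a) * hs

end

theorem second_difference_pos_of_RH (hRH : RiemannHypothesis) (k n : ℕ)
    (hk : 3 * 10 ^ 13 ≤ k) (hn1 : 1 ≤ n)
    (hn2 : (n : ℝ) ≤ Real.log (k * Real.log k) - 1) :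
    0 < 2 * (primePi ((n * k : ℕ) + (k : ℝ) / 2) : ℝ) -
      primePi ((n * k : ℕ) : ℝ) - primePi ((n * k + k : ℕ) : ℝ) := by
  push_cast
  exact second_difference_pos_of_threshold hRH (by exact_mod_cast hk) (by exact_mod_cast hn1) hn2
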